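/- arXiv:1909.13173 — 6 statements merged into one kernel-verified Lean document; each statement's English description precedes it below -/
import Mathlib

section
/- Let p be an odd prime and r a positive integer. Then Σ_{k=0}^{p^r−1} ((4k+1)/(−64)^k) · C(2k,k)^3 ≡ (−1)^{(p−1)r/2}·p^r (mod p^{r+2}), where C(2k,k) is the central binomial coefficient. -/
open Finset

/-- `a ≡ b (mod p^m)` for rationals: the `p`-adic valuation of `a - b` is at least `m`. -/
def pcong (p m : ℕ) (a b : ℚ) : Prop :=
  a = b ∨ (m : ℤ) ≤ padicValRat p (a - b)

section WZPair

variable {K : Type*} [Field K]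

/-- The Pochhammer symbol `(1/2)_k`. -/
def halfPoch (K : Type*) [Field K] (k : ℕ) : K := ∏ i ∈ range k, ((i : K) + 1 / 2)

/-- The first member of the WZ pair, without its linear factor `4 * n + 1`. -/
def wzCore (K : Type*) [Field K] (n k : ℕ) : K :=
  (-1) ^ (n + k) * halfPoch K n ^ 2 * halfPoch K (n + k) * (n.descFactorial k : K) /
    ((n.factorial : K) ^ 3 * halfPoch K k ^ 2)

/-- The second member of the WZ pair, with its second argument shifted by one. -/
def wzMate (K : Type*) [Field K] (n k : ℕ) : K :=
  (-1) ^ (n + k + 1) * 2 * (n : K) ^ 2 * halfPoch K n ^ 2 * halfPoch K (n + k) *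
    (n.descFactorial (k + 1) : K) / ((n.factorial : K) ^ 3 * halfPoch K (k + 1) ^ 2)

theorem halfPoch_succ (k : ℕ) : halfPoch K (k + 1) = halfPoch K k * ((k : K) + 1 / 2) :=
  prod_range_succ _ _

theorem cast_descFactorial_succ (n k : ℕ) :
    (n.descFactorial (k + 1) : K) = ((n : K) - k) * n.descFactorial k := by
  rw [Nat.descFactorial_succ]
  rcases le_or_gt k n with h | h
  · push_cast [Nat.cast_sub h]; ring
  · simp [Nat.descFactorial_of_lt h]

theorem cast_succ_descFactorial (n k : ℕ) :
    ((n : K) + 1 - k) * ((n + 1).descFactorial k : K) = (n + 1) * n.descFactorial k := by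
  have h := cast_descFactorial_succ (K := K) (n + 1) k
  rw [Nat.succ_descFactorial_succ] at h
  push_cast at h
  exact h.symm

variable [CharZero K]

theorem natCast_add_half_ne_zero (k : ℕ) : (k : K) + 1 / 2 ≠ 0 := by
  intro h
  have : ((2 * k + 1 : ℕ) : K) = 0 := by push_cast; linear_combination 2 * h
  exact absurd (Nat.cast_eq_zero.mp this) (by omega)

theorem halfPoch_ne_zero (k : ℕ) : halfPoch K k ≠ 0 :=
  prod_ne_zero_iff.mpr fun i _ ↦ natCast_add_half_ne_zero i

theorem halfPoch_eq_centralBinom (k : ℕ) :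
    halfPoch K k = k.centralBinom * k.factorial / 4 ^ k := by
  induction k with
  | zero => simp [halfPoch]
  | succ k ih =>
    have h : ((k : K) + 1) * (k + 1).centralBinom = 2 * (2 * k + 1) * k.centralBinom := by
      exact_mod_cast Nat.succ_mul_centralBinom_succ k
    rw [halfPoch_succ, ih, Nat.factorial_succ, pow_succ]
    push_cast
    field_simp
    linear_combination (-2 * (k.factorial : K)) * h

theorem wz_equation (n k : ℕ) :
    (4 * (n : K) + 1) * wzCore K n k - (4 * (n : K) + 1) * wzCore K n (k + 1) =
      wzMate K (n + 1) k - wzMate K n k := by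
  have hk := natCast_add_half_ne_zero (K := K) k
  have hn : (n : K) + 1 ≠ 0 := Nat.cast_add_one_ne_zero n
  have hf : (n.factorial : K) ≠ 0 := Nat.cast_ne_zero.mpr n.factorial_ne_zero
  have hh := halfPoch_ne_zero (K := K) k
  have e : n + 1 + k = (n + k) + 1 := by ring
  simp only [wzCore, wzMate, e, ← add_assoc, Nat.succ_descFactorial_succ, Nat.factorial_succ,
    Nat.cast_mul, cast_descFactorial_succ, halfPoch_succ, pow_succ, Nat.cast_add, Nat.cast_one]
  generalize halfPoch K k = a at *
  generalize halfPoch K n = b at *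
  generalize halfPoch K (n + k) = c at *
  generalize (n.factorial : K) = f at *
  generalize (n.descFactorial k : K) = d at *
  generalize (-1 : K) ^ (n + k) = s at *
  generalize hx : (k : K) + 1 / 2 = x at *
  have hk' : (k : K) = x - 1 / 2 := by rw [← hx]; ring
  rw [hk']
  field_simp
  ring

theorem wzMate_zero_left (k : ℕ) : wzMate K 0 k = 0 := by simp [wzMate]

theorem sum_wzCore_zero (N M : ℕ) :
    ∑ n ∈ range N, (4 * (n : K) + 1) * wzCore K n 0 =
      ∑ n ∈ range N, (4 * (n : K) + 1) * wzCore K n M + ∑ k ∈ range M, wzMate K N k := by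
  induction M with
  | zero => simp
  | succ M ih =>
    have h : ∑ n ∈ range N, ((4 * (n : K) + 1) * wzCore K n M -
        (4 * (n : K) + 1) * wzCore K n (M + 1)) = wzMate K N M := by
      simp_rw [wz_equation, sum_range_sub (fun n ↦ wzMate K n M), wzMate_zero_left, sub_zero]
    rw [sum_sub_distrib] at h
    rw [ih, sum_range_succ]
    linear_combination h

theorem wzCore_zero_right (n : ℕ) :
    (4 * (n : K) + 1) * wzCore K n 0 =
      (4 * (n : K) + 1) / (-64) ^ n * (((2 * n).choose n : ℕ) : K) ^ 3 := by
  have hf : (n.factorial : K) ≠ 0 := Nat.cast_ne_zero.mpr n.factorial_ne_zero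
  have h : (-64 : K) ^ n = (-1) ^ n * (4 ^ n) ^ 3 := by
    rw [← pow_mul, mul_comm n 3, pow_mul, ← mul_pow]; norm_num
  have hs : ((-1 : K) ^ n) ^ 2 = 1 := by rw [← pow_mul, mul_comm, pow_mul]; simp
  have hs0 : (-1 : K) ^ n ≠ 0 := pow_ne_zero _ (by simp)
  have h0 : halfPoch K 0 = 1 := prod_range_zero _
  rw [wzCore, h, h0, add_zero, halfPoch_eq_centralBinom, Nat.centralBinom,
    Nat.descFactorial_zero, Nat.cast_one]
  field_simp
  linear_combination ((4 * (n : K) + 1) * ((2 * n).choose n : K) ^ 3) * hs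

theorem wzCore_eq_zero_of_lt {n k : ℕ} (h : n < k) : wzCore K n k = 0 := by
  simp [wzCore, Nat.descFactorial_of_lt h]

theorem wzCore_succ_left (n k : ℕ) :
    wzCore K (n + 1) k * (((n : K) + 1) ^ 2 * (n + 1 - k)) =
      -(((n : K) + 1 / 2) ^ 2 * (n + k + 1 / 2)) * wzCore K n k := by
  have hn : (n : K) + 1 ≠ 0 := Nat.cast_add_one_ne_zero n
  have hf : (n.factorial : K) ≠ 0 := Nat.cast_ne_zero.mpr n.factorial_ne_zero
  have hh := halfPoch_ne_zero (K := K) k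
  have hd := cast_succ_descFactorial (K := K) n k
  have e : n + 1 + k = (n + k) + 1 := by ring
  simp only [wzCore, e, Nat.factorial_succ, halfPoch_succ, pow_succ, Nat.cast_mul, Nat.cast_add,
    Nat.cast_one]
  generalize halfPoch K k = a at *
  generalize halfPoch K n = b at *
  generalize halfPoch K (n + k) = c at *
  generalize (n.factorial : K) = f at *
  generalize ((n + 1).descFactorial k : K) = d' at *
  generalize (n.descFactorial k : K) = d at *
  generalize (-1 : K) ^ (n + k) = s at *
  field_simp
  linear_combination (-s * b ^ 2 * c * (2 * n + 1) ^ 2 * (2 * (n + k) + 1)) * hd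

theorem wzMate_succ_right (n k : ℕ) :
    wzMate K n (k + 1) * (2 * k + 3) ^ 2 =
      -2 * (2 * n + 2 * k + 1) * (n - k - 1) * wzMate K n k := by
  have hk := natCast_add_half_ne_zero (K := K) (k + 1)
  have hf : (n.factorial : K) ≠ 0 := Nat.cast_ne_zero.mpr n.factorial_ne_zero
  have hh := halfPoch_ne_zero (K := K) (k + 1)
  simp only [wzMate, ← add_assoc, halfPoch_succ (k + 1), halfPoch_succ (n + k), pow_succ,
    cast_descFactorial_succ n (k + 1)]
  generalize halfPoch K (k + 1) = a at *
  generalize hx : ((k + 1 : ℕ) : K) + 1 / 2 = x at *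
  have hk' : (k : K) = x - 3 / 2 := by rw [← hx]; push_cast; ring
  push_cast
  rw [hk']
  field_simp
  ring

theorem wzMate_zero_right (n : ℕ) :
    wzMate K n 0 = (-1) ^ (n + 1) * 8 * ((n : K) * n.centralBinom / 4 ^ n) ^ 3 := by
  have hf : (n.factorial : K) ≠ 0 := Nat.cast_ne_zero.mpr n.factorial_ne_zero
  have h1 : halfPoch K 1 = 1 / 2 := by simp [halfPoch]
  simp only [wzMate, zero_add, add_zero, h1, halfPoch_eq_centralBinom, Nat.descFactorial_one]
  field_simp
  norm_num
  ring

theorem prod_range_odd_symm (y : K) (m : ℕ) :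
    ∏ i ∈ range (2 * m + 1), (y - m + i) = y * ∏ j ∈ range m, (y ^ 2 - ((j : K) + 1) ^ 2) := by
  induction m with
  | zero => simp
  | succ m ih =>
    rw [show 2 * (m + 1) + 1 = (2 * m + 1) + 1 + 1 by ring, prod_range_succ, prod_range_succ',
      prod_range_succ _ m, ← mul_assoc, ← ih]
    have h : ∀ i ∈ range (2 * m + 1), y - ((m + 1 : ℕ) : K) + ((i + 1 : ℕ) : K) = y - m + i := by
      intros; push_cast; ring
    rw [prod_congr rfl h]
    push_cast
    ring

theorem wzCore_diag (m : ℕ) :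
    (4 * (m : K) + 1) * wzCore K m m =
      (-1) ^ m * (2 * m + 1) *
        ∏ j ∈ range m, (1 - ((2 * (m : K) + 1) / (2 * ((j : K) + 1))) ^ 2) := by
  have hf : (m.factorial : K) ≠ 0 := Nat.cast_ne_zero.mpr m.factorial_ne_zero
  have hh := halfPoch_ne_zero (K := K) m
  have h := prod_range_odd_symm ((m : K) + 1 / 2) m
  simp only [add_sub_cancel_left] at h
  have h1 : halfPoch K (2 * m + 1) = ∏ i ∈ range (2 * m + 1), (1 / 2 + (i : K)) :=
    prod_congr rfl fun i _ ↦ add_comm _ _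
  have h2 : ∏ j ∈ range m, (((m : K) + 1 / 2) ^ 2 - ((j : K) + 1) ^ 2) =
      (-1) ^ m * (m.factorial : K) ^ 2 *
        ∏ j ∈ range m, (1 - ((2 * (m : K) + 1) / (2 * ((j : K) + 1))) ^ 2) := by
    have e : (-1 : K) ^ m * (m.factorial : K) ^ 2 = ∏ j ∈ range m, (-((j : K) + 1) ^ 2) := by
      rw [prod_neg, card_range, prod_pow, ← prod_range_add_one_eq_factorial]
      push_cast
      rfl
    rw [e, ← prod_mul_distrib]
    refine prod_congr rfl fun j _ ↦ ?_
    have : (j : K) + 1 ≠ 0 := Nat.cast_add_one_ne_zero j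
    field_simp
    ring
  rw [← h1, h2, halfPoch_succ] at h
  have hs : (-1 : K) ^ (m + m) = 1 := by rw [← two_mul, pow_mul]; simp
  rw [wzCore, Nat.descFactorial_self, hs, ← two_mul]
  push_cast at h
  generalize ∏ j ∈ range m, (1 - ((2 * (m : K) + 1) / (2 * ((j : K) + 1))) ^ 2) = P at *
  field_simp
  linear_combination 2 * h

end WZPair

section Norms

variable {p : ℕ} [hp : Fact p.Prime]

theorem padic_norm_two (hodd : Odd p) : ‖(2 : ℚ_[p])‖ = 1 := by
  have h := (Nat.coprime_primes hp.out Nat.prime_two).mpr (by rintro rfl; revert hodd; decide)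
  exact_mod_cast Padic.norm_natCast_eq_one_iff.mpr h

theorem not_pow_dvd_mul_centralBinom {r t : ℕ} (ht : 0 < t) (htr : 2 * t < p ^ r) :
    ¬ p ^ r ∣ t * t.centralBinom := by
  have hr : 0 < r := by
    rcases Nat.eq_zero_or_pos r with rfl | h
    · simp at htr; omega
    · exact h
  have hc := t.centralBinom_ne_zero
  rw [hp.out.pow_dvd_iff_le_factorization (mul_ne_zero ht.ne' hc),
    Nat.factorization_mul ht.ne' hc, Nat.centralBinom, two_mul, Finsupp.add_apply,
    Nat.factorization_choose' hp.out (b := r) (Nat.log_lt_of_lt_pow (by omega) (by omega)),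
    Nat.factorization_eq_card_pow_dvd_of_lt hp.out ht (b := r) (by omega),
    ← card_union_of_disjoint]
  · have := card_le_card (union_subset (filter_subset (fun i ↦ p ^ i ∣ t) (Ico 1 r))
      (filter_subset (fun i ↦ p ^ i ≤ t % p ^ i + t % p ^ i) (Ico 1 r)))
    rw [Nat.card_Ico] at this
    omega
  · refine disjoint_filter.mpr fun i _ hi h ↦ ?_
    rw [Nat.mod_eq_zero_of_dvd hi] at h
    exact absurd h (by simp [hp.out.ne_zero])

theorem not_pow_dvd_mul_two_mul_add_one {r s : ℕ} (hsr : 2 * (s + 1) < p ^ r) :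
    ¬ p ^ r ∣ (s + 1) * (2 * s + 1) := by
  have hr : r ≠ 0 := by rintro rfl; simp at hsr
  have hc : Nat.Coprime (s + 1) (2 * s + 1) := by
    rw [show 2 * s + 1 = (s + 1) + s by ring]
    simp
  rw [Nat.Coprime.isPrimePow_dvd_mul hc (hp.out.isPrimePow.pow hr)]
  rintro (h | h) <;> have := Nat.le_of_dvd (by omega) h <;> omega

theorem le_norm_of_not_pow_dvd {r x : ℕ} (h : ¬ p ^ (r + 1) ∣ x) :
    (p : ℝ)⁻¹ ^ r ≤ ‖(x : ℚ_[p])‖ := by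
  by_contra! hlt
  have := (Padic.norm_lt_pow_iff_norm_le_pow_sub_one (x : ℚ_[p]) (-r)).mp
    (by simpa using hlt)
  refine h (Int.natCast_dvd_natCast.mp ?_)
  push_cast
  have h2 := (Padic.norm_int_le_pow_iff_dvd (p := p) x (r + 1)).mp (by
    refine le_trans (by simp) (this.trans (le_of_eq ?_))
    congr 1; push_cast; ring)
  exact_mod_cast h2

theorem norm_add_of_not_pow_dvd {r x : ℕ} (h : ¬ p ^ r ∣ x) (c : ℤ) :
    ‖(c : ℚ_[p]) * p ^ r + x‖ = ‖(x : ℚ_[p])‖ := by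
  have hlt : ‖(c : ℚ_[p]) * p ^ r‖ < ‖(x : ℚ_[p])‖ := by
    have h1 : ‖(c : ℚ_[p]) * p ^ r‖ ≤ (p : ℝ) ^ (-r : ℤ) := by
      rw [norm_mul, Padic.norm_p_pow]
      exact mul_le_of_le_one_left (by positivity) (Padic.norm_int_le_one c)
    refine h1.trans_lt (not_le.mp fun h2 ↦ h ?_)
    have := (Padic.norm_int_le_pow_iff_dvd (p := p) x r).mp (by exact_mod_cast h2)
    exact_mod_cast this
  rw [Padic.add_eq_max_of_ne hlt.ne, max_eq_right hlt.le]

theorem norm_le_of_mul_le {r s : ℕ} (hsr : 2 * (s + 1) < p ^ r) {x : ℚ_[p]}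
    (h : ‖x‖ * (‖(s : ℚ_[p]) + 1‖ ^ 2 * ‖2 * (s : ℚ_[p]) + 1‖ * ‖((s + 1).centralBinom : ℚ_[p])‖) ≤
      ((p : ℝ)⁻¹ ^ r) ^ 3) : ‖x‖ ≤ (p : ℝ)⁻¹ ^ (r + 2) := by
  obtain ⟨r, rfl⟩ : ∃ q, r = q + 1 := Nat.exists_eq_succ_of_ne_zero (by rintro rfl; simp at hsr)
  have h1 := le_norm_of_not_pow_dvd (not_pow_dvd_mul_centralBinom s.succ_pos hsr)
  have h2 := le_norm_of_not_pow_dvd (not_pow_dvd_mul_two_mul_add_one hsr)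
  push_cast at h1 h2
  rw [norm_mul] at h1 h2
  have hp0 : 0 < (p : ℝ)⁻¹ := inv_pos.mpr (by exact_mod_cast hp.out.pos)
  have h3 := mul_le_mul h1 h2 (by positivity) (by positivity)
  have h4 := (mul_le_mul_of_nonneg_left h3 (norm_nonneg x)).trans (le_trans (le_of_eq (by ring)) h)
  refine le_of_mul_le_mul_right (h4.trans (le_of_eq (by ring))) (by positivity)

theorem norm_prod_sub_one_le {ι : Type*} (s : Finset ι) (f : ι → ℚ_[p]) {ε : ℝ} (hε : 0 ≤ ε)
    (hε1 : ε ≤ 1) (h : ∀ i ∈ s, ‖f i - 1‖ ≤ ε) : ‖∏ i ∈ s, f i - 1‖ ≤ ε := by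
  classical
  induction s using Finset.induction_on with
  | empty => simpa
  | insert a s ha ih =>
    have h1 := h a (mem_insert_self _ _)
    have h2 := ih fun i hi ↦ h i (mem_insert_of_mem hi)
    have h3 : ‖f a‖ ≤ 1 := by
      calc ‖f a‖ = ‖(f a - 1) + 1‖ := by rw [sub_add_cancel]
        _ ≤ max ‖f a - 1‖ ‖(1 : ℚ_[p])‖ := Padic.nonarchimedean _ _
        _ ≤ 1 := max_le (h1.trans hε1) (by simp)
    rw [prod_insert ha, show f a * ∏ i ∈ s, f i - 1 = f a * (∏ i ∈ s, f i - 1) + (f a - 1) by ring]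
    refine (Padic.nonarchimedean _ _).trans (max_le ?_ h1)
    rw [norm_mul]
    exact (mul_le_of_le_one_left (norm_nonneg _) h3).trans h2

end Norms

section Estimates

variable {p : ℕ} [hp : Fact p.Prime]

theorem norm_centralBinom_succ (hodd : Odd p) (s : ℕ) :
    ‖(s : ℚ_[p]) + 1‖ * ‖((s + 1).centralBinom : ℚ_[p])‖ =
      ‖2 * (s : ℚ_[p]) + 1‖ * ‖(s.centralBinom : ℚ_[p])‖ := by
  have h : ((s : ℚ_[p]) + 1) * (s + 1).centralBinom = 2 * (2 * s + 1) * s.centralBinom := by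
    exact_mod_cast Nat.succ_mul_centralBinom_succ s
  simpa [padic_norm_two hodd] using congrArg norm h

theorem norm_wzMate_mul_le (hodd : Odd p) {r : ℕ} (s : ℕ) (hs : 2 * (s + 1) < p ^ r) :
    ‖wzMate ℚ_[p] (p ^ r) s‖ *
      (‖(s : ℚ_[p]) + 1‖ * ‖2 * (s : ℚ_[p]) + 1‖ * ‖((s + 1).centralBinom : ℚ_[p])‖) ≤
      ((p : ℝ)⁻¹ ^ r) ^ 3 := by
  have h2 := padic_norm_two hodd
  induction s with
  | zero =>
    have h4 : ‖(4 : ℚ_[p])‖ = 1 := by rw [show (4 : ℚ_[p]) = 2 * 2 by norm_num]; simp [h2]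
    have h8 : ‖(8 : ℚ_[p])‖ = 1 := by rw [show (8 : ℚ_[p]) = 2 * 4 by norm_num]; simp [h2, h4]
    have hc : ‖((p ^ r).centralBinom : ℚ_[p])‖ ≤ 1 := by
      exact_mod_cast Padic.norm_int_le_one (p := p) ((p ^ r).centralBinom : ℤ)
    rw [wzMate_zero_right]
    simp only [norm_mul, norm_pow, norm_div, norm_neg, norm_one, one_pow, h8, h4, Nat.cast_pow,
      Padic.norm_p, Nat.cast_zero, zero_add, mul_zero, one_mul, div_one,
      show Nat.centralBinom 1 = 2 from rfl,
      Nat.cast_ofNat, h2, mul_one]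
    gcongr
    exact mul_le_of_le_one_right (by positivity) hc
  | succ s ih =>
    have e := congrArg norm (wzMate_succ_right (K := ℚ_[p]) (p ^ r) s)
    have e1 : ‖2 * ((p ^ r : ℕ) : ℚ_[p]) + 2 * s + 1‖ = ‖2 * (s : ℚ_[p]) + 1‖ := by
      have := norm_add_of_not_pow_dvd (p := p) (r := r) (x := 2 * s + 1)
        (fun h ↦ by have := Nat.le_of_dvd (by omega) h; omega) 2
      push_cast at this ⊢
      rw [← this]; congr 1; ring
    have e2 : ‖((p ^ r : ℕ) : ℚ_[p]) - s - 1‖ = ‖(s : ℚ_[p]) + 1‖ := by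
      have := norm_add_of_not_pow_dvd (p := p) (r := r) (x := s + 1)
        (fun h ↦ by have := Nat.le_of_dvd (by omega) h; omega) (-1)
      push_cast at this ⊢
      rw [← this, ← norm_neg]; congr 1; ring
    simp only [norm_mul, norm_neg, norm_pow, h2, e1, e2] at e
    have hc := norm_centralBinom_succ hodd (s + 1)
    have e3 : 2 * ((s + 1 : ℕ) : ℚ_[p]) + 1 = 2 * s + 3 := by push_cast; ring
    rw [e3] at hc ⊢
    refine le_trans (le_of_eq ?_) (ih (by omega))
    linear_combination ‖wzMate ℚ_[p] (p ^ r) (s + 1)‖ * ‖2 * (s : ℚ_[p]) + 3‖ * hc +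
      ‖((s + 1).centralBinom : ℚ_[p])‖ * e

theorem norm_diag_sub_le (hodd : Odd p) {r m : ℕ} (hm : p ^ r = 2 * m + 1) :
    ‖∏ j ∈ range m, (1 - ((2 * (m : ℚ_[p]) + 1) / (2 * ((j : ℚ_[p]) + 1))) ^ 2) - 1‖ ≤
      (p : ℝ)⁻¹ ^ 2 := by
  have hp0 : 0 < (p : ℝ)⁻¹ := inv_pos.mpr (by exact_mod_cast hp.out.pos)
  have hp1 : (p : ℝ)⁻¹ ≤ 1 := inv_le_one_of_one_le₀ (by exact_mod_cast hp.out.one_lt.le)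
  refine norm_prod_sub_one_le _ _ (by positivity) (pow_le_one₀ hp0.le hp1) fun j hj ↦ ?_
  have hj := mem_range.mp hj
  obtain ⟨r, rfl⟩ : ∃ q, r = q + 1 := Nat.exists_eq_succ_of_ne_zero (by rintro rfl; simp at hm; omega)
  have hmK : 2 * (m : ℚ_[p]) + 1 = p ^ (r + 1) := by exact_mod_cast hm.symm
  have h1 := le_norm_of_not_pow_dvd (p := p) (r := r) (x := j + 1)
    (fun h ↦ by have := Nat.le_of_dvd (by omega) h; omega)
  push_cast at h1
  rw [hmK, sub_sub_cancel_left, norm_neg, norm_pow, norm_div, norm_mul, padic_norm_two hodd,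
    norm_pow, Padic.norm_p, one_mul]
  gcongr
  rw [div_le_iff₀ (lt_of_lt_of_le (by positivity) h1), pow_succ']
  gcongr

theorem norm_wzCore_mul_le (hodd : Odd p) {r m : ℕ} (hm : p ^ r = 2 * m + 1) (s : ℕ)
    (hs : 2 * (s + 1) < p ^ r) :
    ‖wzCore ℚ_[p] (m + s + 1) m‖ *
      (‖(s : ℚ_[p]) + 1‖ ^ 2 * ‖2 * (s : ℚ_[p]) + 1‖ * ‖((s + 1).centralBinom : ℚ_[p])‖) ≤
      ((p : ℝ)⁻¹ ^ r) ^ 3 := by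
  have h2 := padic_norm_two hodd
  have hmK : 2 * (m : ℚ_[p]) + 1 = p ^ r := by exact_mod_cast hm.symm
  have hmK' : (m : ℚ_[p]) = (p ^ r - 1) / 2 := by rw [← hmK]; ring
  have key : ∀ (c x : ℕ), 0 < x → x < p ^ r →
      ‖((c : ℚ_[p]) * p ^ r + x) / 2‖ = ‖(x : ℚ_[p])‖ := fun c x h0 h ↦ by
    have := norm_add_of_not_pow_dvd (p := p) (r := r) (x := x)
      (fun h' ↦ by have := Nat.le_of_dvd h0 h'; omega) c
    rw [norm_div, h2, div_one]; exact_mod_cast this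
  induction s with
  | zero =>
    have e := wzCore_succ_left (K := ℚ_[p]) m m
    have hd := wzCore_diag (K := ℚ_[p]) m
    have hP := norm_diag_sub_le (p := p) hodd hm
    generalize ∏ j ∈ range m, (1 - ((2 * (m : ℚ_[p]) + 1) / (2 * ((j : ℚ_[p]) + 1))) ^ 2) = P at *
    have hP1 : ‖P‖ ≤ 1 := by
      have hp1 : (p : ℝ)⁻¹ ≤ 1 := inv_le_one_of_one_le₀ (by exact_mod_cast hp.out.one_lt.le)
      rw [← sub_add_cancel P 1]
      exact (Padic.nonarchimedean _ _).trans
        (max_le (hP.trans (pow_le_one₀ (by positivity) hp1)) (by simp))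
    have h1 := key 1 1 one_pos (by omega)
    have hstep : wzCore ℚ_[p] (m + 1) m * ((((1 : ℕ) : ℚ_[p]) * p ^ r + (1 : ℕ)) / 2) ^ 2 =
        -((p ^ r / 2) ^ 2 / 2 * ((-1) ^ m * p ^ r * P)) := by
      rw [hmK] at hd
      rw [← hd, ← hmK]
      push_cast
      linear_combination e
    have hnorm := congrArg norm hstep
    rw [norm_mul, norm_pow, h1] at hnorm
    simp only [norm_mul, norm_pow, norm_div, norm_neg, norm_one, one_pow, h2, Padic.norm_p,
      Nat.cast_one, one_mul, mul_one, div_one] at hnorm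
    simp only [add_zero, Nat.cast_zero, zero_add, mul_zero, norm_one, one_pow, mul_one,
      show Nat.centralBinom 1 = 2 from rfl, Nat.cast_ofNat, h2, hnorm]
    rw [pow_succ _ 2]
    gcongr
    exact mul_le_of_le_one_right (by positivity) hP1
  | succ s ih =>
    have e := congrArg norm (wzCore_succ_left (K := ℚ_[p]) (m + s + 1) m)
    have e1 : ‖((m + s + 1 : ℕ) : ℚ_[p]) + 1‖ = ‖2 * (s : ℚ_[p]) + 3‖ := by
      have := key 1 (2 * s + 3) (by omega) (by omega)
      push_cast at this ⊢
      rw [← this, hmK']; congr 1; ring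
    have e2 : ‖((m + s + 1 : ℕ) : ℚ_[p]) + 1 / 2‖ = ‖(s : ℚ_[p]) + 1‖ := by
      have := key 1 (2 * (s + 1)) (by omega) (by omega)
      push_cast at this ⊢
      rw [norm_mul 2, h2, one_mul (M := ℝ)] at this
      rw [← this, hmK']; congr 1; ring
    have e3 : ‖((m + s + 1 : ℕ) : ℚ_[p]) + m + 1 / 2‖ = ‖2 * (s : ℚ_[p]) + 1‖ := by
      have := key 2 (2 * s + 1) (by omega) (by omega)
      push_cast at this ⊢
      rw [← this, hmK']; congr 1; ring
    have e4 : ((m + s + 1 : ℕ) : ℚ_[p]) + 1 - m = ((s + 1 : ℕ) : ℚ_[p]) + 1 := by push_cast; ring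
    simp only [norm_mul, norm_neg, norm_pow, e1, e2, e3, e4] at e
    have hc := norm_centralBinom_succ hodd (s + 1)
    have e5 : 2 * ((s + 1 : ℕ) : ℚ_[p]) + 1 = 2 * s + 3 := by push_cast; ring
    rw [e5] at hc ⊢
    refine le_trans (le_of_eq ?_) (ih (by omega))
    rw [← add_assoc m s 1]
    linear_combination ‖wzCore ℚ_[p] (m + s + 1 + 1) m‖ * ‖2 * (s : ℚ_[p]) + 3‖ *
      ‖((s + 1 : ℕ) : ℚ_[p]) + 1‖ * hc + ‖((s + 1).centralBinom : ℚ_[p])‖ * e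

theorem norm_sum_sub_le (hodd : Odd p) {r m : ℕ} (hm : p ^ r = 2 * m + 1) :
    ‖∑ k ∈ range (p ^ r), (4 * (k : ℚ_[p]) + 1) / (-64) ^ k * (((2 * k).choose k : ℕ) : ℚ_[p]) ^ 3 -
      (-1) ^ m * (p : ℚ_[p]) ^ r‖ ≤ (p : ℝ)⁻¹ ^ (r + 2) := by
  have hp1 : (p : ℝ)⁻¹ ≤ 1 := inv_le_one_of_one_le₀ (by exact_mod_cast hp.out.one_lt.le)
  have hmK : 2 * (m : ℚ_[p]) + 1 = p ^ r := by exact_mod_cast hm.symm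
  have hsplit : ∑ n ∈ range (p ^ r), (4 * (n : ℚ_[p]) + 1) * wzCore ℚ_[p] n m =
      (4 * (m : ℚ_[p]) + 1) * wzCore ℚ_[p] m m + ∑ s ∈ range m,
        (4 * ((m + s + 1 : ℕ) : ℚ_[p]) + 1) * wzCore ℚ_[p] (m + s + 1) m := by
    rw [hm, show 2 * m + 1 = m + (m + 1) by ring, sum_range_add, sum_range_succ',
      sum_eq_zero fun n hn ↦ by rw [wzCore_eq_zero_of_lt (mem_range.mp hn), mul_zero]]
    simp only [add_zero, zero_add, add_assoc]
    rw [add_comm]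
  simp_rw [← wzCore_zero_right]
  rw [sum_wzCore_zero (p ^ r) m, hsplit, wzCore_diag]
  have hA : ‖∑ s ∈ range m, (4 * ((m + s + 1 : ℕ) : ℚ_[p]) + 1) * wzCore ℚ_[p] (m + s + 1) m‖ ≤
      (p : ℝ)⁻¹ ^ (r + 2) := by
    refine IsUltrametricDist.norm_sum_le_of_forall_le_of_nonneg (by positivity) fun s hs ↦ ?_
    have hs : 2 * (s + 1) < p ^ r := by have := mem_range.mp hs; omega
    rw [norm_mul]
    refine (mul_le_of_le_one_left (norm_nonneg _) ?_).trans
      (norm_le_of_mul_le hs (norm_wzCore_mul_le hodd hm s hs))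
    exact_mod_cast Padic.norm_int_le_one (p := p) (4 * (m + s + 1 : ℕ) + 1)
  have hB : ‖∑ k ∈ range m, wzMate ℚ_[p] (p ^ r) k‖ ≤ (p : ℝ)⁻¹ ^ (r + 2) := by
    refine IsUltrametricDist.norm_sum_le_of_forall_le_of_nonneg (by positivity) fun s hs ↦ ?_
    have hs : 2 * (s + 1) < p ^ r := by have := mem_range.mp hs; omega
    refine norm_le_of_mul_le hs (le_trans ?_ (norm_wzMate_mul_le hodd s hs))
    gcongr
    refine pow_le_of_le_one (norm_nonneg _) ?_ two_ne_zero
    exact_mod_cast Padic.norm_int_le_one (p := p) (s + 1)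
  have hC := norm_diag_sub_le (p := p) hodd hm
  generalize ∑ k ∈ range m, wzMate ℚ_[p] (p ^ r) k = B at *
  generalize ∑ s ∈ range m, (4 * ((m + s + 1 : ℕ) : ℚ_[p]) + 1) * wzCore ℚ_[p] (m + s + 1) m = A
    at *
  generalize ∏ j ∈ range m, (1 - ((2 * (m : ℚ_[p]) + 1) / (2 * ((j : ℚ_[p]) + 1))) ^ 2) = P at *
  rw [hmK, show (-1) ^ m * (p : ℚ_[p]) ^ r * P + A + B - (-1) ^ m * (p : ℚ_[p]) ^ r =
    (-1) ^ m * (p : ℚ_[p]) ^ r * (P - 1) + A + B by ring]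
  refine (Padic.nonarchimedean _ _).trans (max_le ((Padic.nonarchimedean _ _).trans
    (max_le ?_ hA)) hB)
  simp only [norm_mul, norm_pow, norm_neg, norm_one, one_pow, one_mul, Padic.norm_p]
  rw [pow_add]
  gcongr

end Estimates

theorem exists_odd_pow_eq (q r : ℕ) :
    ∃ m, (2 * q + 1) ^ r = 2 * m + 1 ∧ (-1 : ℚ) ^ m = (-1) ^ (q * r) := by
  induction r with
  | zero => exact ⟨0, by simp⟩
  | succ r ih =>
    obtain ⟨m, h1, h2⟩ := ih
    refine ⟨2 * (m * q) + m + q, by rw [pow_succ, h1]; ring, ?_⟩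
    rw [pow_add, pow_add, pow_mul, h2, mul_add, pow_add]
    simp

theorem stmt_2 (p : ℕ) (hp : p.Prime) (hodd : Odd p) (r : ℕ) (hr : 0 < r) :
    pcong p (r + 2)
      (∑ k ∈ range (p ^ r),
        (4 * (k : ℚ) + 1) / (-64) ^ k * (((2 * k).choose k : ℕ) : ℚ) ^ 3)
      ((-1) ^ ((p - 1) * r / 2) * (p : ℚ) ^ r) := by
  have : Fact p.Prime := ⟨hp⟩
  obtain ⟨q, hq⟩ := id hodd
  obtain ⟨m, hm, hsign⟩ := exists_odd_pow_eq q r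
  rw [← hq] at hm
  have hexp : (p - 1) * r / 2 = q * r := by
    rw [hq, Nat.add_sub_cancel, mul_assoc, Nat.mul_div_cancel_left _ two_pos]
  rw [hexp, ← hsign, pcong, or_iff_not_imp_left]
  intro hne
  have h := norm_sum_sub_le (p := p) hodd hm
  generalize hS : ∑ k ∈ range (p ^ r),
        (4 * (k : ℚ) + 1) / (-64) ^ k * (((2 * k).choose k : ℕ) : ℚ) ^ 3 = S at *
  have hcast : ∑ k ∈ range (p ^ r), (4 * (k : ℚ_[p]) + 1) / (-64) ^ k *
      (((2 * k).choose k : ℕ) : ℚ_[p]) ^ 3 - (-1) ^ m * (p : ℚ_[p]) ^ r =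
      ((S - (-1) ^ m * (p : ℚ) ^ r : ℚ) : ℚ_[p]) := by
    rw [← hS]; push_cast; rfl
  rw [hcast, Padic.eq_padicNorm, padicNorm.eq_zpow_of_nonzero (sub_ne_zero.mpr hne)] at h
  rw [Rat.cast_zpow, Rat.cast_natCast, inv_pow, ← zpow_natCast (p : ℝ), ← zpow_neg,
    zpow_le_zpow_iff_right₀ (by exact_mod_cast hp.one_lt)] at h
  exact neg_le_neg_iff.mp h
end

section
/- Let p be an odd prime and r a positive integer. Then Σ_{k=0}^{p^r−1} (−1)^k (4k−1) · (−1/2)_k^3 / (k!)^3 ≡ −(−1)^{(p−1)r/2}·p^r (mod p^{r+2}). -/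
open Finset

/-- The rising factorial `(a)_n = a(a+1)⋯(a+n-1)`. -/
noncomputable def rf (a : ℚ) (n : ℕ) : ℚ := (ascPochhammer ℚ n).eval a

/-- The quotient `(a)_n / n!`. -/
def risingQuot (a : ℚ) (n : ℕ) : ℚ := ∏ j ∈ range n, (a + j) / (j + 1)

/-- The product `(1 - x)_n (1 + x)_n` as a polynomial in `y = x ^ 2`. -/
def lowerProd (y : ℚ) (n : ℕ) : ℚ := ∏ j ∈ range n, (((j : ℚ) + 1) ^ 2 - y)

/-- The product `(-1/2 - x)_n (-1/2 + x)_n` as a polynomial in `y = x ^ 2`. -/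
def upperProd (y : ℚ) (n : ℕ) : ℚ := ∏ j ∈ range n, (((j : ℚ) - 1 / 2) ^ 2 - y)

/-- The product `(a)_n (b)_n`. -/
def pairProd (a b : ℚ) (n : ℕ) : ℚ := ∏ j ∈ range n, ((a + j) * (b + j))

/-- The summand of the theorem with two of the parameters `-1/2` shifted by `x` and `-x`,
where `y = x ^ 2`. -/
def deformedTerm (y : ℚ) (n : ℕ) : ℚ :=
  (-1) ^ n * (4 * n - 1) * risingQuot (-1 / 2) n * (upperProd y n / lowerProd y n)

lemma risingQuot_succ (a : ℚ) (n : ℕ) :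
    risingQuot a (n + 1) = risingQuot a n * ((a + n) / (n + 1)) := prod_range_succ _ _

lemma lowerProd_succ (y : ℚ) (n : ℕ) :
    lowerProd y (n + 1) = lowerProd y n * (((n : ℚ) + 1) ^ 2 - y) := prod_range_succ _ _

lemma upperProd_succ (y : ℚ) (n : ℕ) :
    upperProd y (n + 1) = upperProd y n * (((n : ℚ) - 1 / 2) ^ 2 - y) := prod_range_succ _ _

lemma pairProd_succ (a b : ℚ) (n : ℕ) :
    pairProd a b (n + 1) = pairProd a b n * ((a + n) * (b + n)) := prod_range_succ _ _

lemma lowerProd_ne_zero {y : ℚ} (hy : ∀ j : ℕ, ((j : ℚ) + 1) ^ 2 - y ≠ 0) (n : ℕ) :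
    lowerProd y n ≠ 0 := prod_ne_zero_iff.2 fun j _ => hy j

lemma pairProd_shift_left (a b : ℚ) (n : ℕ) :
    a * pairProd (a + 1) b n = (a + n) * pairProd a b n := by
  induction n with
  | zero => simp [pairProd]
  | succ n ih =>
    rw [pairProd_succ, pairProd_succ]
    push_cast
    linear_combination (a + 1 + n) * (b + n) * ih

lemma pairProd_comm (a b : ℚ) (n : ℕ) : pairProd a b n = pairProd b a n := by
  simp only [pairProd, mul_comm]

lemma pairProd_shift_right (a b : ℚ) (n : ℕ) :
    b * pairProd a (b + 1) n = (b + n) * pairProd a b n := by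
  rw [pairProd_comm a, pairProd_comm a, pairProd_shift_left]

lemma pairProd_neg_nat (b : ℚ) {m n : ℕ} (h : m < n) : pairProd (-m) b n = 0 :=
  prod_eq_zero (mem_range.2 h) (by simp)

lemma pairProd_zero_right (a : ℚ) {n : ℕ} (h : 0 < n) : pairProd a 0 n = 0 :=
  prod_eq_zero (mem_range.2 h) (by simp)

lemma pairProd_succ_left (a b : ℚ) (n : ℕ) :
    pairProd a b (n + 1) = a * (b + n) * pairProd (a + 1) b n := by
  rw [pairProd_succ]
  linear_combination -(b + n) * pairProd_shift_left a b n

lemma pairProd_succ_right (a b : ℚ) (n : ℕ) :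
    pairProd a b (n + 1) = b * (a + n) * pairProd a (b + 1) n := by
  rw [pairProd_comm, pairProd_succ_left, pairProd_comm a]

/-- Telescoped form of the contiguous relation behind the Pfaff–Saalschütz sum. -/
lemma saalschutz_telescope {y : ℚ} (hy : ∀ j : ℕ, ((j : ℚ) + 1) ^ 2 - y ≠ 0) (N : ℚ) (K : ℕ) :
    ∑ k ∈ range (K + 1), risingQuot (3 / 2) k / lowerProd y k *
        (((N + 1) ^ 2 - y) * pairProd (-(N + 1)) (N + 1 / 2) k
          - ((N - 1 / 2) ^ 2 - y) * pairProd (-N) (N - 1 / 2) k)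
      = (2 * N + 1 / 2) * (K + 3 / 2) * risingQuot (3 / 2) K * pairProd (-N) (N + 1 / 2) K
          / lowerProd y K := by
  induction K with
  | zero =>
    simp [risingQuot, lowerProd, pairProd]
    ring
  | succ K ih =>
    have h1 := pairProd_succ_left (-(N + 1)) (N + 1 / 2) K
    rw [show -(N + 1) + 1 = -N by ring] at h1
    have h2 := pairProd_succ_right (-N) (N - 1 / 2) K
    rw [show N - 1 / 2 + 1 = N + 1 / 2 by ring] at h2
    rw [sum_range_succ, ih, h1, h2, pairProd_succ, risingQuot_succ, lowerProd_succ]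
    have hB := lowerProd_ne_zero hy K
    have hK := hy K
    have : (K : ℚ) + 1 ≠ 0 := by positivity
    push_cast
    field_simp
    ring

/-- A special case of the Pfaff–Saalschütz summation. -/
lemma saalschutz {y : ℚ} (hy : ∀ j : ℕ, ((j : ℚ) + 1) ^ 2 - y ≠ 0) (N : ℕ) :
    ∑ k ∈ range (N + 1), risingQuot (3 / 2) k / lowerProd y k * pairProd (-N) (N - 1 / 2) k
      = upperProd y N / lowerProd y N := by
  induction N with
  | zero => simp [risingQuot, lowerProd, upperProd, pairProd]
  | succ N ih =>
    have h := saalschutz_telescope hy N (N + 1)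
    rw [pairProd_neg_nat _ N.lt_succ_self] at h
    have ih' : ∑ k ∈ range (N + 2),
        risingQuot (3 / 2) k / lowerProd y k * pairProd (-N) (N - 1 / 2) k
          = upperProd y N / lowerProd y N := by
      rw [sum_range_succ, ih, pairProd_neg_nat _ N.lt_succ_self, mul_zero, add_zero]
    rw [upperProd_succ, lowerProd_succ, mul_div_mul_comm, ← ih', eq_comm, mul_div_assoc',
      div_eq_iff (hy N), eq_comm, ← sub_eq_zero, sum_mul, sum_mul, ← sum_sub_distrib]
    simp only [mul_zero, zero_div] at h
    rw [← h]
    refine sum_congr rfl fun k _ => ?_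
    push_cast
    rw [show (N : ℚ) + 1 - 1 / 2 = N + 1 / 2 by ring]
    ring

/-- A truncated well-poised sum as a multiple of a terminating `₃F₂`. -/
lemma sum_deformedTerm {y : ℚ} (hy : ∀ j : ℕ, ((j : ℚ) + 1) ^ 2 - y ≠ 0) (N : ℕ) :
    ∑ n ∈ range (N + 1), deformedTerm y n
      = (-1) ^ N * (2 * (N + 1) * risingQuot (-1 / 2) (N + 1)) *
        ∑ k ∈ range (N + 1), risingQuot (3 / 2) k / lowerProd y k *
          pairProd (-N) (N + 1 / 2) k := by
  induction N with
  | zero => norm_num [deformedTerm, risingQuot, lowerProd, upperProd, pairProd]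
  | succ N ih =>
    have hext : ∑ k ∈ range (N + 1), risingQuot (3 / 2) k / lowerProd y k *
        pairProd (-N) (N + 1 / 2) k = ∑ k ∈ range (N + 2),
          risingQuot (3 / 2) k / lowerProd y k * pairProd (-N) (N + 1 / 2) k := by
      rw [sum_range_succ _ (N + 1), pairProd_neg_nat _ N.lt_succ_self, mul_zero, add_zero]
    have hq : 2 * ((N : ℚ) + 2) * risingQuot (-1 / 2) (N + 2)
        = (2 * N + 1) * risingQuot (-1 / 2) (N + 1) := by
      rw [risingQuot_succ _ (N + 1)]
      have : (N : ℚ) + 2 ≠ 0 := by positivity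
      push_cast
      rw [show (N : ℚ) + 1 + 1 = N + 2 by ring]
      field_simp
      ring
    rw [sum_range_succ, ih, hext, deformedTerm, ← saalschutz hy (N + 1)]
    push_cast
    rw [show (N : ℚ) + 1 + 1 = N + 2 by ring, hq, mul_sum, mul_sum, mul_sum, ← sum_add_distrib]
    refine sum_congr rfl fun k _ => ?_
    have h1 := pairProd_shift_left (-(N + 1 : ℚ)) (N + 1 / 2) k
    rw [show -(N + 1 : ℚ) + 1 = -N by ring] at h1
    have h2 := pairProd_shift_right (-(N + 1 : ℚ)) (N + 1 / 2) k
    rw [show (N : ℚ) + 1 / 2 + 1 = N + 1 + 1 / 2 by ring] at h2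
    rw [show (N : ℚ) + 1 - 1 / 2 = N + 1 / 2 by ring, pow_succ]
    linear_combination (-1) ^ N * risingQuot (-1 / 2) (N + 1) *
      (risingQuot (3 / 2) k / lowerProd y k) * (2 * h2 - 2 * h1)

lemma half_odd_sq_ne (m : ℤ) (j : ℕ) : ((j : ℚ) + 1) ^ 2 - (m - 1 / 2) ^ 2 ≠ 0 := by
  intro h
  have h' : ((j : ℚ) + 3 / 2 - m) * (j + 1 / 2 + m) = 0 := by linear_combination h
  rcases mul_eq_zero.1 h' with h | h
  · have : (2 * j + 3 - 2 * m : ℚ) = 0 := by linear_combination 2 * h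
    have : (2 * j + 3 - 2 * m : ℤ) = 0 := by exact_mod_cast this
    omega
  · have : (2 * j + 1 + 2 * m : ℚ) = 0 := by linear_combination 2 * h
    have : (2 * j + 1 + 2 * m : ℤ) = 0 := by exact_mod_cast this
    omega

lemma upperProd_half_odd (m : ℚ) (n : ℕ) :
    upperProd ((m - 1 / 2) ^ 2) n = pairProd (-m) (m - 1) n :=
  prod_congr rfl fun _ _ => by ring

lemma lowerProd_half_odd (m : ℚ) (n : ℕ) :
    lowerProd ((m - 1 / 2) ^ 2) n = pairProd (3 / 2 - m) (m + 1 / 2) n :=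
  prod_congr rfl fun _ _ => by ring

lemma pairProd_half_odd_ne_zero (m : ℕ) (n : ℕ) : pairProd (3 / 2 - m) (m + 3 / 2) n ≠ 0 := by
  refine prod_ne_zero_iff.2 fun j _ => mul_ne_zero ?_ (by positivity)
  intro h
  have : (3 - 2 * m + 2 * j : ℚ) = 0 := by linear_combination 2 * h
  have : (3 - 2 * m + 2 * j : ℤ) = 0 := by exact_mod_cast this
  omega

lemma deformedTerm_telescope (m : ℕ) (K : ℕ) :
    ∑ n ∈ range (K + 1), ((2 * m - 1) * deformedTerm ((m + 1 - 1 / 2) ^ 2) n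
        + (2 * m + 1) * deformedTerm ((m - 1 / 2) ^ 2) n)
      = (-1) ^ K * (4 * m * (2 * K - 1)) * risingQuot (-1 / 2) K * pairProd (-m) m K
          / pairProd (3 / 2 - m) (m + 3 / 2) K := by
  induction K with
  | zero =>
    simp [deformedTerm, risingQuot, lowerProd, upperProd, pairProd]
    ring
  | succ K ih =>
    have hQ := pairProd_half_odd_ne_zero m K
    have hQ' := pairProd_half_odd_ne_zero m (K + 1)
    rw [pairProd_succ] at hQ'
    have hl : (3 / 2 - m + K : ℚ) ≠ 0 := fun h => hQ' (by rw [h]; ring)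
    have hr : (m + 3 / 2 + K : ℚ) ≠ 0 := by positivity
    have hm : (m + 1 / 2 : ℚ) ≠ 0 := by positivity
    have hm' : (1 / 2 - m : ℚ) ≠ 0 := by
      intro h
      have : (1 - 2 * m : ℚ) = 0 := by linear_combination 2 * h
      have : (1 - 2 * m : ℤ) = 0 := by exact_mod_cast this
      omega
    have hK : (K : ℚ) + 1 ≠ 0 := by positivity
    have u1 := pairProd_succ_left (-(m + 1 : ℚ)) m K
    rw [show -(m + 1 : ℚ) + 1 = -m by ring] at u1
    have u2 := pairProd_succ_right (-(m : ℚ)) (m - 1) K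
    rw [show (m : ℚ) - 1 + 1 = m by ring] at u2
    have l1 := pairProd_succ_left (1 / 2 - m : ℚ) (m + 3 / 2) K
    rw [show (1 / 2 - m : ℚ) + 1 = 3 / 2 - m by ring] at l1
    have l2 := pairProd_succ_right (3 / 2 - m : ℚ) (m + 1 / 2) K
    rw [show (m + 1 / 2 : ℚ) + 1 = m + 3 / 2 by ring] at l2
    rw [sum_range_succ, ih, deformedTerm, deformedTerm, upperProd_half_odd, upperProd_half_odd,
      lowerProd_half_odd, lowerProd_half_odd, show (m + 1 - 1 : ℚ) = m by ring,
      show (3 / 2 - (m + 1) : ℚ) = 1 / 2 - m by ring,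
      show (m + 1 + 1 / 2 : ℚ) = m + 3 / 2 by ring, u1, u2, l1, l2, pairProd_succ,
      pairProd_succ, risingQuot_succ, pow_succ]
    push_cast
    generalize hL : (3 / 2 - m + K : ℚ) = L at *
    generalize hR : (m + 3 / 2 + K : ℚ) = R at *
    generalize hM : (m + 1 / 2 : ℚ) = M at *
    generalize hM' : (1 / 2 - m : ℚ) = P at *
    field_simp
    rw [← hL, ← hR, ← hM, ← hM']
    ring

/-- Evaluation of the deformed sum at the half-odd points `x = m - 1/2`. -/
lemma sum_deformedTerm_half_odd {m L : ℕ} (hm : 0 < m) (hL : m < L) :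
    ∑ n ∈ range L, deformedTerm ((m - 1 / 2) ^ 2) n = (-1) ^ m * (2 * m - 1) := by
  induction m, Nat.succ_le_of_lt hm using Nat.le_induction with
  | base =>
    obtain ⟨L, rfl⟩ := Nat.exists_eq_add_of_lt hL
    rw [sum_eq_single_of_mem 0 (by simp)]
    · norm_num [deformedTerm, risingQuot, upperProd, lowerProd]
    · intro n _ hn
      rw [deformedTerm, upperProd_half_odd]
      simp [pairProd_zero_right _ (Nat.pos_of_ne_zero hn)]
  | succ m hm1 ih =>
    have ih := ih hm1 (by omega)
    obtain ⟨K, rfl⟩ : ∃ K, L = K + 1 := ⟨L - 1, by omega⟩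
    have h := deformedTerm_telescope m K
    rw [pairProd_neg_nat _ (by omega), sum_add_distrib, ← mul_sum, ← mul_sum, ih] at h
    have h1 : (2 * m - 1 : ℚ) ≠ 0 := by
      have : (1 : ℚ) ≤ m := by exact_mod_cast hm1
      linarith
    refine mul_left_cancel₀ h1 ?_
    push_cast
    simp only [mul_zero, zero_div] at h
    rw [pow_succ (-1 : ℚ) m]
    linear_combination h

lemma rf_div_factorial (a : ℚ) (n : ℕ) : rf a n / n.factorial = risingQuot a n := by
  induction n with
  | zero => simp [rf, risingQuot]
  | succ n ih =>
    rw [risingQuot_succ, ← ih, rf, ascPochhammer_succ_eval, Nat.factorial_succ, ← rf]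
    push_cast
    rw [mul_comm ((n : ℚ) + 1), mul_div_mul_comm]

lemma upperProd_zero_div_lowerProd_zero (n : ℕ) :
    upperProd 0 n / lowerProd 0 n = risingQuot (-1 / 2) n ^ 2 := by
  rw [upperProd, lowerProd, risingQuot, ← prod_div_distrib, ← prod_pow]
  exact prod_congr rfl fun j _ => by rw [div_pow]; ring

lemma deformedTerm_zero (k : ℕ) : deformedTerm 0 k
    = (-1) ^ k * (4 * (k : ℚ) - 1) * rf (-1 / 2) k ^ 3 / (k.factorial : ℚ) ^ 3 := by
  rw [deformedTerm, upperProd_zero_div_lowerProd_zero, mul_div_assoc, ← div_pow,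
    rf_div_factorial]
  ring

section Padic

variable {p : ℕ} [Fact p.Prime]

lemma padicNorm_risingQuot_le_one {a : ℚ} (ha : padicNorm p a ≤ 1) (n : ℕ) :
    padicNorm p (risingQuot a n) ≤ 1 := by
  have ha' : ‖(a : ℚ_[p])‖ ≤ 1 := by rw [Padic.eq_padicNorm]; exact_mod_cast ha
  let z : ℤ_[p] := ⟨a, ha'⟩
  have hz : (((ascPochhammer ℤ_[p] n).eval z : ℤ_[p]) : ℚ_[p]) = (rf a n : ℚ) := by
    induction n with
    | zero => simp [rf]
    | succ n ih =>
      rw [ascPochhammer_succ_eval, rf, ascPochhammer_succ_eval, ← rf]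
      push_cast
      rw [ih]
  have key : (risingQuot a n : ℚ_[p]) = (Ring.multichoose z n : ℤ_[p]) := by
    have h := congrArg (fun z : ℤ_[p] => (z : ℚ_[p]))
      (Ring.factorial_nsmul_multichoose_eq_ascPochhammer z n)
    have hf : ((n.factorial : ℕ) : ℚ_[p]) ≠ 0 := by exact_mod_cast n.factorial_ne_zero
    rw [Polynomial.ascPochhammer_smeval_eq_eval, hz] at h
    rw [← rf_div_factorial]
    push_cast
    rw [div_eq_iff hf, ← h]
    simp [mul_comm]
  have h : ‖(risingQuot a n : ℚ_[p])‖ ≤ 1 := key ▸ PadicInt.norm_le_one _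
  rw [Padic.eq_padicNorm] at h
  exact_mod_cast h

lemma padicNorm_prime_pow (r : ℕ) : padicNorm p ((p : ℚ) ^ r) = ((p : ℚ)⁻¹) ^ r := by
  induction r with
  | zero => simp
  | succ r ih => rw [pow_succ, padicNorm.mul, ih, padicNorm.padicNorm_p_of_prime, pow_succ]

lemma padicNorm_two (hodd : Odd p) : padicNorm p 2 = 1 := by
  have hp : p.Prime := Fact.out
  have h := (padicNorm.nat_eq_one_iff (p := p) 2).2 fun h => by
    have := (Nat.prime_dvd_prime_iff_eq hp Nat.prime_two).1 h
    subst this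
    exact absurd hodd (by decide)
  exact_mod_cast h

lemma padicNorm_half_pow_div_le (hodd : Odd p) {r j : ℕ} (hj : 0 < j) (hjr : j < p ^ r) :
    padicNorm p ((p : ℚ) ^ r / 2 / j) ≤ (p : ℚ)⁻¹ := by
  have hp : p.Prime := Fact.out
  have hp0 : (p : ℚ) ≠ 0 := by exact_mod_cast hp.ne_zero
  obtain ⟨s, u, hu, rfl⟩ := Nat.exists_eq_pow_mul_and_not_dvd hj.ne' p hp.ne_one
  have hu0 : 0 < u := Nat.pos_of_ne_zero fun h => hu (h ▸ dvd_zero p)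
  have hs : s < r := (Nat.pow_lt_pow_iff_right hp.one_lt).1
    ((Nat.le_mul_of_pos_right _ hu0).trans_lt hjr)
  obtain ⟨d, rfl⟩ := Nat.exists_eq_add_of_lt hs
  have hu' : (u : ℚ) ≠ 0 := by exact_mod_cast hu0.ne'
  have e : (p : ℚ) ^ (s + d + 1) / 2 / ((p ^ s * u : ℕ) : ℚ) = p * (p ^ d : ℕ) / 2 / u := by
    push_cast
    field_simp
    ring
  rw [e, padicNorm.div, padicNorm.div, padicNorm.mul, padicNorm_two hodd,
    (padicNorm.nat_eq_one_iff u).2 hu, padicNorm.padicNorm_p_of_prime, div_one, div_one]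
  exact mul_le_of_le_one_right (by positivity) (padicNorm.of_nat _)

lemma padicNorm_div_one_sub_sub_one_le {u z e : ℚ} (he : e < 1) (hu : padicNorm p (u - 1) ≤ e)
    (hz : padicNorm p z ≤ e) : padicNorm p (u / (1 - z) - 1) ≤ e := by
  have h1 : padicNorm p (1 - z) = 1 := by
    have hne : padicNorm p 1 ≠ padicNorm p (-z) := by
      rw [padicNorm.one, padicNorm.neg]
      exact (hz.trans_lt he).ne'
    rw [sub_eq_add_neg, padicNorm.add_eq_max_of_ne hne, padicNorm.one, padicNorm.neg]
    exact max_eq_left (hz.trans he.le)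
  have h0 : 1 - z ≠ 0 := fun h => by simp [h] at h1
  rw [show u / (1 - z) - 1 = (u - 1 + z) / (1 - z) by field_simp; ring, padicNorm.div, h1,
    div_one]
  exact padicNorm.nonarchimedean.trans (max_le hu hz)

lemma padicNorm_lowerProd_ratio_le (hodd : Odd p) {r k : ℕ} (hk : k < p ^ r) :
    padicNorm p (lowerProd 0 k / lowerProd (((p : ℚ) ^ r / 2) ^ 2) k - 1) ≤ ((p : ℚ)⁻¹) ^ 2 := by
  have hp : p.Prime := Fact.out
  have hp1 : (p : ℚ)⁻¹ < 1 := inv_lt_one_of_one_lt₀ (by exact_mod_cast hp.one_lt)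
  induction k with
  | zero => simp [lowerProd]
  | succ k ih =>
    have hz := padicNorm_half_pow_div_le hodd k.succ_pos hk
    have hz2 : padicNorm p (((p : ℚ) ^ r / 2 / (k + 1 : ℕ)) ^ 2) ≤ ((p : ℚ)⁻¹) ^ 2 := by
      rw [pow_two, padicNorm.mul, pow_two]
      exact mul_le_mul hz hz (padicNorm.nonneg _) (by positivity)
    have h := padicNorm_div_one_sub_sub_one_le (pow_lt_one₀ (by positivity) hp1 two_ne_zero)
      (ih (by omega)) hz2
    convert h using 2
    rw [lowerProd_succ, lowerProd_succ, mul_div_mul_comm, div_eq_mul_inv _ (1 - _)]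
    have hk : (k : ℚ) + 1 ≠ 0 := by positivity
    congr 2
    rw [← inv_div, sub_div, sub_zero, div_self (pow_ne_zero 2 hk), div_pow _ ((k + 1 : ℕ) : ℚ)]
    push_cast
    rfl

lemma pairProd_div_lowerProd_zero (a b : ℚ) (k : ℕ) :
    pairProd a b k / lowerProd 0 k = risingQuot a k * risingQuot b k := by
  rw [pairProd, lowerProd, risingQuot, risingQuot, ← prod_div_distrib, ← prod_mul_distrib]
  exact prod_congr rfl fun j _ => by rw [sub_zero, pow_two, mul_div_mul_comm]

/-- The truncated sum is insensitive modulo `p ^ (r + 2)` to the deformation `x = p ^ r / 2`. -/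
lemma padicNorm_sum_deformedTerm_sub_le (hodd : Odd p) (r : ℕ)
    (hy : ∀ j : ℕ, ((j : ℚ) + 1) ^ 2 - ((p : ℚ) ^ r / 2) ^ 2 ≠ 0) :
    padicNorm p (∑ n ∈ range (p ^ r), deformedTerm 0 n
      - ∑ n ∈ range (p ^ r), deformedTerm (((p : ℚ) ^ r / 2) ^ 2) n)
      ≤ ((p : ℚ)⁻¹) ^ (r + 2) := by
  have hp : p.Prime := Fact.out
  have hy0 : ∀ j : ℕ, ((j : ℚ) + 1) ^ 2 - 0 ≠ 0 := fun j => by rw [sub_zero]; positivity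
  obtain ⟨N, hN⟩ : ∃ N, p ^ r = N + 1 := ⟨p ^ r - 1, by have := pow_pos hp.pos r; omega⟩
  have hN' : (N : ℚ) + 1 = p ^ r := by exact_mod_cast hN.symm
  have h2 := padicNorm_two hodd
  have hint : ∀ b : ℤ, padicNorm p (b / 2 : ℚ) ≤ 1 := fun b => by
    rw [padicNorm.div, h2, div_one]
    exact padicNorm.of_int b
  set y := ((p : ℚ) ^ r / 2) ^ 2
  have e : ∀ k, risingQuot (3 / 2) k / lowerProd 0 k * pairProd (-N) (N + 1 / 2) k
      - risingQuot (3 / 2) k / lowerProd y k * pairProd (-N) (N + 1 / 2) k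
      = -(risingQuot (3 / 2) k * (risingQuot (-N) k * risingQuot (N + 1 / 2) k)
        * (lowerProd 0 k / lowerProd y k - 1)) := fun k => by
    rw [← pairProd_div_lowerProd_zero]
    have := lowerProd_ne_zero hy0 k
    have := lowerProd_ne_zero hy k
    field_simp
    ring
  have hr := padicNorm_prime_pow (p := p) r
  rw [hN, sum_deformedTerm hy0, sum_deformedTerm hy, ← mul_sub, ← sum_sub_distrib, hN',
    padicNorm.mul, padicNorm.mul, padicNorm.mul, padicNorm.mul, h2, one_mul, hr, pow_add]
  have hsgn : padicNorm p ((-1) ^ N) = 1 := by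
    rcases neg_one_pow_eq_or ℚ N with h | h <;> simp [h]
  rw [hsgn, one_mul]
  refine mul_le_mul (mul_le_of_le_one_right (by positivity)
    (padicNorm_risingQuot_le_one (by simpa using hint (-1)) _)) ?_ (padicNorm.nonneg _)
    (by positivity)
  refine padicNorm.sum_le' (fun k hk => ?_) (by positivity)
  rw [e, padicNorm.neg, padicNorm.mul, padicNorm.mul, padicNorm.mul]
  refine (mul_le_of_le_one_left (padicNorm.nonneg _) ?_).trans
    (padicNorm_lowerProd_ratio_le hodd (by rw [hN]; exact mem_range.1 hk))
  refine mul_le_one₀ (padicNorm_risingQuot_le_one (by simpa using hint 3) _)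
    (mul_nonneg (padicNorm.nonneg _) (padicNorm.nonneg _))
    (mul_le_one₀ (padicNorm_risingQuot_le_one ?_ _) (padicNorm.nonneg _)
      (padicNorm_risingQuot_le_one ?_ _))
  · rw [padicNorm.neg]
    exact padicNorm.of_nat N
  · have := hint (2 * N + 1)
    push_cast at this
    rwa [show (N : ℚ) + 1 / 2 = (2 * N + 1) / 2 by ring]

end Padic

lemma pcong_of_padicNorm_le {p m : ℕ} [Fact p.Prime] {a b : ℚ}
    (h : padicNorm p (a - b) ≤ ((p : ℚ)⁻¹) ^ m) : pcong p m a b := by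
  have hp : p.Prime := Fact.out
  refine or_iff_not_imp_left.2 fun hab => ?_
  rw [padicNorm.eq_zpow_of_nonzero (sub_ne_zero.2 hab), inv_pow, ← zpow_natCast, ← zpow_neg,
    zpow_le_zpow_iff_right₀ (by exact_mod_cast hp.one_lt)] at h
  omega

lemma neg_one_pow_half_pow_sub_one {p : ℕ} (hodd : Odd p) (r : ℕ) :
    (-1 : ℚ) ^ ((p ^ r - 1) / 2) = (-1) ^ ((p - 1) * r / 2) := by
  obtain ⟨t, ht⟩ := hodd
  rw [show (p - 1) * r / 2 = t * r by
    rw [ht, Nat.add_sub_cancel, mul_assoc, Nat.mul_div_cancel_left _ two_pos]]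
  induction r with
  | zero => simp
  | succ r ih =>
    obtain ⟨u, hu⟩ : Odd (p ^ r) := Odd.pow ⟨t, ht⟩
    rw [hu, show (2 * u + 1 - 1) / 2 = u by omega] at ih
    have e : 2 * (2 * u * t + u + t) + 1 = (2 * u + 1) * (2 * t + 1) := by ring
    rw [pow_succ p, hu, ht, ← e, show (2 * (2 * u * t + u + t) + 1 - 1) / 2 = 2 * u * t + u + t by
      omega, mul_add, mul_one, pow_add, pow_add, pow_add, ih, mul_assoc, pow_mul]
    simp

theorem stmt_3 (p : ℕ) (hp : p.Prime) (hodd : Odd p) (r : ℕ) (hr : 0 < r) :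
    pcong p (r + 2)
      (∑ k ∈ range (p ^ r),
        (-1) ^ k * (4 * (k : ℚ) - 1) * (rf (-1/2) k) ^ 3 / (k.factorial : ℚ) ^ 3)
      (-((-1) ^ ((p - 1) * r / 2) * (p : ℚ) ^ r)) := by
  have : Fact p.Prime := ⟨hp⟩
  obtain ⟨t, ht⟩ : Odd (p ^ r) := hodd.pow
  have ht' : (p : ℚ) ^ r = 2 * t + 1 := by exact_mod_cast ht
  have hhalf : (p : ℚ) ^ r / 2 = ((t + 1 : ℕ) : ℚ) - 1 / 2 := by
    rw [ht']
    push_cast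
    ring
  have ht0 : 0 < t := by
    have := Nat.one_lt_pow hr.ne' hp.one_lt
    omega
  have hval := sum_deformedTerm_half_odd (m := t + 1) (L := p ^ r) t.succ_pos (by omega)
  rw [← hhalf] at hval
  have h := padicNorm_sum_deformedTerm_sub_le hodd r fun j => by
    rw [hhalf]
    exact_mod_cast half_odd_sq_ne (t + 1 : ℕ) j
  refine pcong_of_padicNorm_le ?_
  simp only [← deformedTerm_zero]
  convert h using 3
  rw [hval, ← neg_one_pow_half_pow_sub_one hodd, ht', ht, show (2 * t + 1 - 1) / 2 = t by omega]
  push_cast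
  ring
end

section
/- Let p be an odd prime. Then Σ_{n=0}^{(p−1)/2} (1/2)_n^2 / ((n+1)·(n!)^2) ≡ 2p² + 2p³(2q_p(2) − 1) (mod p^4). -/
open Finset

lemma rf_zero (a : ℚ) : rf a 0 = 1 := by simp [rf]

lemma rf_succ (a : ℚ) (n : ℕ) : rf a (n + 1) = rf a n * (a + n) := by
  simp [rf, ascPochhammer_succ_eval]

lemma rf_half_mul_four_pow (n : ℕ) :
    rf (1 / 2) n * 4 ^ n = n.factorial * n.centralBinom := by
  induction n with
  | zero => simp [rf_zero]
  | succ n ih =>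
    have h : ((n + 1 : ℕ) : ℚ) * (n + 1).centralBinom = 2 * (2 * n + 1) * n.centralBinom := by
      exact_mod_cast Nat.succ_mul_centralBinom_succ n
    rw [rf_succ, Nat.factorial_succ]
    push_cast at h ⊢
    linear_combination (4 * (1 / 2 + n) : ℚ) * ih - (n.factorial : ℚ) * h

/-- The sum of `(1/2)_n ^ 2 / ((n + 1) * n! ^ 2)` telescopes. -/
lemma sum_rf_half_sq_div (N : ℕ) :
    ∑ n ∈ range N, (rf (1 / 2) n) ^ 2 / (((n : ℚ) + 1) * (n.factorial : ℚ) ^ 2)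
      = 4 * N * (rf (1 / 2) N) ^ 2 / (N.factorial : ℚ) ^ 2 := by
  induction N with
  | zero => simp
  | succ N ih =>
    have h₁ : (N.factorial : ℚ) ≠ 0 := by positivity
    have h₂ : (N : ℚ) + 1 ≠ 0 := by positivity
    rw [sum_range_succ, ih, rf_succ, Nat.factorial_succ]
    push_cast
    field_simp
    ring

lemma two_pow_mul_prod_odd (m : ℕ) :
    2 ^ m * ∏ i ∈ range m, (2 * i + 1) = m.factorial * m.centralBinom := by
  induction m with
  | zero => simp
  | succ m ih =>
    have h := Nat.succ_mul_centralBinom_succ m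
    rw [prod_range_succ, Nat.factorial_succ]
    linear_combination (2 * (2 * m + 1)) * ih - m.factorial * h

lemma prod_two_mul_add_one_sub (m : ℕ) :
    ∏ i ∈ range m, ((2 * m + 1 : ℤ) - (i + 1)) = m.factorial * m.centralBinom := by
  have h := Nat.descFactorial_eq_prod_range (2 * m) m
  rw [Nat.descFactorial_eq_factorial_mul_choose] at h
  rw [Nat.centralBinom_eq_two_mul_choose, ← Nat.cast_mul, h, Nat.cast_prod]
  refine prod_congr rfl fun i hi => ?_
  have := mem_range.mp hi
  rw [Nat.cast_sub (by omega)]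
  push_cast
  ring

/-- A form of Morley's congruence modulo the square of the prime. -/
lemma centralBinom_modEq (m : ℕ) (hp : (2 * m + 1).Prime) :
    (m.centralBinom : ℤ) ≡ (-16) ^ m [ZMOD (2 * m + 1) ^ 2] := by
  set p : ℤ := 2 * m + 1 with hpm
  have hodd : ∏ i ∈ range m, (p - 2 * (i + 1)) = ∏ i ∈ range m, (2 * (i : ℤ) + 1) := by
    rw [← prod_range_reflect]
    refine prod_congr rfl fun i hi => ?_
    have := mem_range.mp hi
    rw [Nat.sub_sub, Nat.cast_sub (by omega)]
    push_cast
    ring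
  have hsq : ∏ i ∈ range m, (p - 2 * ((i : ℤ) + 1)) ^ 2
      ≡ ∏ i ∈ range m, (-4 * (((i : ℤ) + 1) * (p - (i + 1)))) [ZMOD p ^ 2] := by
    refine Int.ModEq.prod fun i _ => (Int.modEq_iff_dvd.mpr ⟨-1, by ring⟩)
  have hfac : ∏ i ∈ range m, ((i : ℤ) + 1) = m.factorial := by
    exact_mod_cast prod_range_add_one_eq_factorial m
  have hodd' : (2 : ℤ) ^ m * ∏ i ∈ range m, (2 * (i : ℤ) + 1)
      = m.factorial * m.centralBinom := by
    exact_mod_cast two_pow_mul_prod_odd m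
  rw [prod_pow, hodd, prod_mul_distrib, prod_mul_distrib, hfac, prod_two_mul_add_one_sub,
    prod_const, card_range] at hsq
  have key := hsq.mul_left ((2 : ℤ) ^ m * 2 ^ m)
  have hl : (2 : ℤ) ^ m * 2 ^ m * (∏ i ∈ range m, (2 * (i : ℤ) + 1)) ^ 2
      = (m.factorial * (m.factorial * m.centralBinom)) * m.centralBinom := by
    linear_combination (2 ^ m * ∏ i ∈ range m, (2 * (i : ℤ) + 1)
      + m.factorial * m.centralBinom) * hodd'
  have hr : (2 : ℤ) ^ m * 2 ^ m * ((-4) ^ m * (m.factorial * (m.factorial * m.centralBinom)))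
      = (m.factorial * (m.factorial * m.centralBinom)) * (-16) ^ m := by
    rw [show (-16 : ℤ) = 2 * 2 * (-4) by norm_num, mul_pow, mul_pow]
    ring
  rw [hl, hr] at key
  have hpf : ¬ (2 * m + 1) ∣ m.factorial * (m.factorial * m.centralBinom) := by
    intro h
    rw [hp.dvd_mul, hp.dvd_mul, hp.dvd_factorial, Nat.centralBinom_eq_two_mul_choose] at h
    have hc : ¬ (2 * m + 1) ∣ (2 * m).choose m := fun hd => by
      have := (hp.dvd_factorial (n := 2 * m)).mp
        (Nat.choose_mul_factorial_mul_factorial (show m ≤ 2 * m by omega) ▸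
          (hd.mul_right _).mul_right _)
      omega
    rcases h with h | h | h
    · omega
    · omega
    · exact hc h
  have hcop : IsCoprime (p ^ 2) ((m.factorial * (m.factorial * m.centralBinom) : ℕ) : ℤ) := by
    refine IsCoprime.pow_left ?_
    have := Nat.isCoprime_iff_coprime.mpr ((Nat.Prime.coprime_iff_not_dvd hp).mpr hpf)
    simpa [hpm] using this
  rw [Int.modEq_iff_dvd] at key ⊢
  refine hcop.dvd_of_dvd_mul_left ?_
  push_cast
  rwa [mul_sub]

/-- Numerators divisible by `p ^ m` over denominators prime to `p` are congruent to zero. -/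
lemma pcong_of_mul_sub_eq {p m : ℕ} (hp : p.Prime) {a b : ℚ} {k d : ℤ} (hd : ¬ (p : ℤ) ∣ d)
    (h : d * (a - b) = p ^ m * k) : pcong p m a b := by
  have := Fact.mk hp
  by_cases hab : a = b
  · exact Or.inl hab
  right
  have hab' : a - b ≠ 0 := sub_ne_zero.mpr hab
  have hp0 : (p : ℚ) ≠ 0 := by exact_mod_cast hp.ne_zero
  have hd0 : (d : ℚ) ≠ 0 := by
    rintro h0
    exact hd (by simp [Int.cast_eq_zero.mp h0])
  have hk0 : (k : ℚ) ≠ 0 := by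
    rintro h0
    rw [h0, mul_zero] at h
    exact (mul_ne_zero hd0 hab') h
  have hv := congrArg (padicValRat p) h
  rw [padicValRat.mul hd0 hab', padicValRat.mul (pow_ne_zero _ hp0) hk0, padicValRat.pow,
    padicValRat.self hp.one_lt, padicValRat.of_int, padicValRat.of_int,
    padicValInt.eq_zero_of_not_dvd hd] at hv
  push_cast at hv
  have : (0 : ℤ) ≤ padicValInt p k := by positivity
  linarith

theorem stmt_4 (p : ℕ) (hp : p.Prime) (hodd : Odd p) :
    pcong p 4
      (∑ n ∈ range ((p - 1) / 2 + 1),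
        (rf (1/2) n) ^ 2 / (((n : ℚ) + 1) * (n.factorial : ℚ) ^ 2))
      (2 * (p : ℚ) ^ 2 + 2 * (p : ℚ) ^ 3 * (2 * (((2 : ℚ) ^ (p - 1) - 1) / (p : ℚ)) - 1)) := by
  obtain ⟨m, rfl⟩ := hodd
  obtain ⟨k, hk⟩ := (Int.modEq_iff_dvd.mp (centralBinom_modEq m hp).symm)
  have hcop : IsCoprime (2 : ℤ) ((2 * m + 1 : ℕ) : ℤ) := ⟨-m, 1, by push_cast; ring⟩
  obtain ⟨q, hq⟩ : ((2 * m + 1 : ℕ) : ℤ) ∣ 4 ^ m - 1 := by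
    have := (Int.ModEq.pow_card_sub_one_eq_one hp hcop).symm.dvd
    rwa [Nat.add_sub_cancel, pow_mul] at this
  have hpd : ¬ ((2 * m + 1 : ℕ) : ℤ) ∣ (m + 1) * 4 ^ m * 4 ^ m := by
    have hpr := Nat.prime_iff_prime_int.mp hp
    intro h
    rw [mul_assoc, ← pow_add, hpr.dvd_mul] at h
    rcases h with h | h
    · have h' : 2 * m + 1 ∣ m + 1 := by exact_mod_cast h
      have := Nat.le_of_dvd (by omega) h'
      have := hp.one_lt
      omega
    · have h4 := hpr.dvd_of_dvd_pow h
      rw [show (4 : ℤ) = 2 * 2 by norm_num, hpr.dvd_mul, or_self] at h4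
      exact hpr.not_isUnit (hcop.isUnit_of_dvd' h4 dvd_rfl)
  have h16 : ((-16 : ℤ) ^ m) ^ 2 = (4 ^ m) ^ 4 := by
    rw [← pow_mul, ← pow_mul, mul_comm m 2, mul_comm m 4, pow_mul, pow_mul]
    norm_num
  rw [Nat.add_sub_cancel, Nat.mul_div_cancel_left _ two_pos, sum_rf_half_sq_div, pow_mul]
  push_cast at hq
  have hC : ∃ l : ℤ, (m.centralBinom : ℤ) ^ 2
      - 2 * (m + 1) * (4 ^ m) ^ 2 * (2 * 4 ^ m - 1 - (2 * m + 1)) = (2 * m + 1) ^ 2 * l := by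
    set P : ℤ := 2 * m + 1 with hP
    have hmP : 2 * ((m : ℤ) + 1) = P + 1 := by rw [hP]; ring
    have hQ : (4 : ℤ) ^ m = 1 + P * q := by linear_combination hq
    have hC' : (m.centralBinom : ℤ) = (-16) ^ m + P ^ 2 * k := by linear_combination hk
    refine ⟨2 * (-16) ^ m * k + P ^ 2 * k ^ 2 + (4 ^ m) ^ 2 * (q ^ 2 - 2 * q + 1), ?_⟩
    rw [hC', hmP]
    have : (4 : ℤ) ^ m * 4 ^ m - (P + 1) * (2 * 4 ^ m - 1 - P) = P ^ 2 * (q ^ 2 - 2 * q + 1) := by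
      rw [hQ]; ring
    linear_combination h16 + (4 ^ m) ^ 2 * this
  obtain ⟨l, hl⟩ := hC
  refine pcong_of_mul_sub_eq (k := l) hp hpd ?_
  have hl' : (m.centralBinom : ℚ) ^ 2
      - 2 * (m + 1) * (4 ^ m) ^ 2 * (2 * 4 ^ m - 1 - (2 * m + 1)) = (2 * m + 1) ^ 2 * l := by
    exact_mod_cast hl
  have hf : (m.factorial : ℚ) ≠ 0 := by positivity
  have hm : (m : ℚ) + 1 ≠ 0 := by positivity
  have hP : (2 * m + 1 : ℚ) ≠ 0 := by positivity
  have h4 : (4 : ℚ) ^ m ≠ 0 := by positivity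
  have hrf : rf (1 / 2) m = m.factorial * m.centralBinom / 4 ^ m := by
    rw [eq_div_iff h4, rf_half_mul_four_pow]
  rw [rf_succ, hrf, Nat.factorial_succ, show ((2 : ℚ) ^ 2) = 4 by norm_num]
  push_cast
  generalize (4 : ℚ) ^ m = Q at *
  have hsum : 4 * ((m : ℚ) + 1) * (m.factorial * m.centralBinom / Q * (1 / 2 + m)) ^ 2
      / ((m + 1) * m.factorial) ^ 2
      = (2 * m + 1) ^ 2 * m.centralBinom ^ 2 / ((m + 1) * Q ^ 2) := by
    field_simp
    ring
  rw [hsum]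
  field_simp
  linear_combination hl'
end

section
/- Let p be an odd prime and r a positive integer. Then Σ_{k=1}^{(p^r−1)/2} G(p^r, k) ≡ 0 (mod p^{r+4}), where G(n,k) = (n + 2k − 1) · (1/2)_n · (1/2 + k)_{n−1}^4 / ((n−1)!)^5 · (−1)^n · 2^{2n+1}. -/
open Finset

/-- \`G(n,k) = (n + 2k − 1) · (1/2)_n · (1/2 + k)_{n−1}^4 / ((n−1)!)^5 · (−1)^n · 2^{2n+1}\`. -/
noncomputable def G (n k : ℕ) : ℚ :=
  ((n : ℚ) + 2 * k - 1) * rf (1/2) n * (rf (1/2 + k) (n - 1)) ^ 4 /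
    ((n - 1).factorial : ℚ) ^ 5 * (-1) ^ n * 2 ^ (2 * n + 1)

lemma norm_rf_le {p : ℕ} [Fact p.Prime] (q : ℚ) (hq : ‖(q : ℚ_[p])‖ ≤ 1) (n : ℕ) :
    ‖((rf q n : ℚ) : ℚ_[p])‖ ≤ ‖(n.factorial : ℚ_[p])‖ := by
  obtain ⟨z, hz⟩ : ∃ z : ℤ_[p], (z : ℚ_[p]) = q := ⟨⟨q, hq⟩, rfl⟩
  have h := PadicInt.norm_ascPochhammer_le n z
  have heval : (((ascPochhammer ℤ_[p] n).eval z : ℤ_[p]) : ℚ_[p]) = ((rf q n : ℚ) : ℚ_[p]) := by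
    have h₁ := ascPochhammer_map (S := ℤ_[p]) (T := ℚ_[p]) PadicInt.Coe.ringHom n
    have h₂ := ascPochhammer_map (S := ℚ) (T := ℚ_[p]) (Rat.castHom ℚ_[p]) n
    have e₁ := Polynomial.eval_map_apply (f := PadicInt.Coe.ringHom) (p := ascPochhammer ℤ_[p] n) z
    have e₂ := Polynomial.eval_map_apply (f := Rat.castHom ℚ_[p]) (p := ascPochhammer ℚ n) q
    rw [h₁] at e₁
    rw [h₂] at e₂
    exact e₁.symm.trans ((congrArg (fun x => (ascPochhammer ℚ_[p] n).eval x) hz).trans e₂)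
  rw [← heval]
  simpa only [PadicInt.norm_def, PadicInt.coe_natCast] using h

lemma rf_succ_left (a : ℚ) (n : ℕ) : rf a (n + 1) = a * rf (a + 1) n := by
  simp [rf, ascPochhammer_succ_left]

lemma norm_two_eq_one {p : ℕ} [hp : Fact p.Prime] (hodd : Odd p) : ‖(2 : ℚ_[p])‖ = 1 := by
  have : ‖((2 : ℕ) : ℚ_[p])‖ = 1 :=
    Padic.norm_natCast_eq_one_iff.2 (Nat.coprime_two_right.2 hodd)
  simpa using this

lemma norm_odd_div_two {p : ℕ} [Fact p.Prime] (hodd : Odd p) (k : ℕ) :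
    ‖((k - 1 / 2 : ℚ) : ℚ_[p])‖ = ‖((2 * k - 1 : ℤ) : ℚ_[p])‖ := by
  have h : ((2 * k - 1 : ℤ) : ℚ_[p]) = 2 * ((k - 1 / 2 : ℚ) : ℚ_[p]) := by
    push_cast
    ring
  rw [h, norm_mul, norm_two_eq_one hodd, one_mul]

lemma term_bound {c A B x t u P : ℝ} (hc : c ≤ t) (hA0 : 0 ≤ A) (hB0 : 0 ≤ B)
    (hx : 0 < x) (hu : 0 < u) (hP : 0 < P) (hA : A ≤ u * x) (hB : t * B ≤ u * x)
    (ht : P * u ≤ t) (huP : P * u ≤ 1) :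
    c * A * B ^ 4 / x ^ 5 ≤ u / P ^ 4 := by
  have ht0 : 0 < t := (mul_pos hP hu).trans_le ht
  have hB' : B ≤ u * x / t := by rwa [le_div_iff₀ ht0, mul_comm]
  calc c * A * B ^ 4 / x ^ 5 ≤ t * (u * x) * (u * x / t) ^ 4 / x ^ 5 := by gcongr
    _ = u ^ 5 / t ^ 3 := by field_simp
    _ ≤ u ^ 5 / (P * u) ^ 3 := by gcongr
    _ = (P * u) * (u / P ^ 4) := by field_simp
    _ ≤ u / P ^ 4 := mul_le_of_le_one_left (by positivity) huP

lemma norm_G_le {p : ℕ} [hp : Fact p.Prime] (hodd : Odd p) {r k : ℕ}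
    (hk : 1 ≤ k) (hk' : 2 * k - 1 < p ^ r) :
    ‖((G (p ^ r) k : ℚ) : ℚ_[p])‖ ≤ (p : ℝ) ^ (-((r + 4 : ℕ) : ℤ)) := by
  have hp0 : (0 : ℝ) < p := mod_cast hp.out.pos
  have h2 := norm_two_eq_one (p := p) hodd
  obtain ⟨m, hm⟩ : ∃ m, p ^ r = m + 1 :=
    ⟨p ^ r - 1, (Nat.sub_add_cancel (Nat.pow_pos hp.out.pos)).symm⟩
  have hn : ‖((m + 1 : ℕ) : ℚ_[p])‖ = ((p : ℝ) ^ r)⁻¹ := by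
    rw [← hm]; push_cast; rw [Padic.norm_p_pow]; simp
  have hfact : ‖((m + 1).factorial : ℚ_[p])‖ = ((p : ℝ) ^ r)⁻¹ * ‖(m.factorial : ℚ_[p])‖ := by
    rw [Nat.factorial_succ, Nat.cast_mul, norm_mul, hn]
  have hA : ‖((rf (1 / 2) (m + 1) : ℚ) : ℚ_[p])‖ ≤
      ((p : ℝ) ^ r)⁻¹ * ‖(m.factorial : ℚ_[p])‖ := by
    rw [← hfact]
    exact norm_rf_le _ (by simp [h2]) _
  have hB : ‖((2 * k - 1 : ℤ) : ℚ_[p])‖ * ‖((rf (1 / 2 + k) m : ℚ) : ℚ_[p])‖ ≤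
      ((p : ℝ) ^ r)⁻¹ * ‖(m.factorial : ℚ_[p])‖ := by
    rw [← hfact, ← norm_odd_div_two hodd, ← norm_mul, ← Rat.cast_mul,
      show (1 / 2 + k : ℚ) = (k - 1 / 2) + 1 by ring, ← rf_succ_left]
    exact norm_rf_le _ ((norm_odd_div_two hodd k).trans_le (Padic.norm_int_le_one _)) _
  have ht : (p : ℝ) * ((p : ℝ) ^ r)⁻¹ ≤ ‖((2 * k - 1 : ℤ) : ℚ_[p])‖ := by
    by_contra! h
    have he : (p : ℝ) * ((p : ℝ) ^ r)⁻¹ = (p : ℝ) ^ (-(r : ℤ) + 1) := by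
      rw [zpow_add₀ hp0.ne', zpow_neg, zpow_natCast, zpow_one, mul_comm]
    rw [he, ← Padic.norm_le_pow_iff_norm_lt_pow_add_one, Padic.norm_int_le_pow_iff_dvd] at h
    have := Int.le_of_dvd (by omega) h
    zify [show 1 ≤ 2 * k by omega] at hk'
    omega
  have hp1 : (1 : ℝ) ≤ p := mod_cast hp.out.one_le
  have hut : ((p : ℝ) ^ r)⁻¹ ≤ ‖((2 * k - 1 : ℤ) : ℚ_[p])‖ :=
    (le_mul_of_one_le_left (by positivity) hp1).trans ht
  have hc : ‖((m + 1 : ℕ) : ℚ_[p]) + ((2 * k - 1 : ℤ) : ℚ_[p])‖ ≤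
      ‖((2 * k - 1 : ℤ) : ℚ_[p])‖ :=
    (Padic.nonarchimedean _ _).trans (max_le (hn.trans_le hut) le_rfl)
  have hx : 0 < ‖(m.factorial : ℚ_[p])‖ :=
    norm_pos_iff.2 (mod_cast m.factorial_ne_zero)
  have key := term_bound hc (norm_nonneg _) (norm_nonneg _) hx (by positivity) hp0 hA hB ht
    (ht.trans (Padic.norm_int_le_one _))
  have hG : ‖((G (p ^ r) k : ℚ) : ℚ_[p])‖ =
      ‖((m + 1 : ℕ) : ℚ_[p]) + ((2 * k - 1 : ℤ) : ℚ_[p])‖ *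
        ‖((rf (1 / 2) (m + 1) : ℚ) : ℚ_[p])‖ * ‖((rf (1 / 2 + k) m : ℚ) : ℚ_[p])‖ ^ 4 /
          ‖(m.factorial : ℚ_[p])‖ ^ 5 := by
    rw [hm, G, Nat.add_sub_cancel]
    simp only [Rat.cast_mul, Rat.cast_div, Rat.cast_pow, norm_mul, norm_div, norm_pow,
      Rat.cast_neg, Rat.cast_one, norm_neg, norm_one, one_pow, mul_one, Rat.cast_natCast,
      Rat.cast_ofNat, h2]
    congr 4
    push_cast
    ring_nf
  rw [hG]
  refine key.trans_eq ?_
  rw [zpow_neg, zpow_natCast, pow_add, mul_inv, div_eq_mul_inv]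

lemma pcong_zero_of_norm_le {p : ℕ} [hp : Fact p.Prime] {m : ℕ} {q : ℚ}
    (h : ‖(q : ℚ_[p])‖ ≤ (p : ℝ) ^ (-(m : ℤ))) : pcong p m q 0 := by
  by_cases hq : q = 0
  · exact Or.inl hq
  · right
    rw [Padic.norm_eq_zpow_neg_valuation (by exact_mod_cast hq), Padic.valuation_ratCast,
      zpow_le_zpow_iff_right₀ (by exact_mod_cast hp.out.one_lt)] at h
    rw [sub_zero]
    omega

theorem stmt_8 (p : ℕ) (hp : p.Prime) (hodd : Odd p) (r : ℕ) (hr : 0 < r) :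
    pcong p (r + 4)
      (∑ k ∈ Icc 1 ((p ^ r - 1) / 2), G (p ^ r) k) 0 := by
  have : Fact p.Prime := ⟨hp⟩
  apply pcong_zero_of_norm_le
  rw [Rat.cast_sum]
  refine IsUltrametricDist.norm_sum_le_of_forall_le_of_nonneg (by positivity) fun k hk => ?_
  rw [Finset.mem_Icc] at hk
  exact norm_G_le hodd hk.1 (by omega)
end

section
/- Let p be an odd prime and r an integer with r ≥ 2. Set P = −p^{3r} · C(2p^r−1, p^r−1)² / ((2p^r−1) · 4^{3p^r−3}). Then P · Σ_{k=1}^{(p^r−1)/2} ((−4)^k / C(2k,k)) · C(2p^r+2k−2, 2k−2) / (k(2k−1)) · C(2p^r−2, p^r−k−1) ≡ 0 (mod p^{r+2}). -/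
open Finset

/-- The `p`-part of `k * n.choose k` is at most the largest power of `p` not exceeding `n`. -/
theorem not_prime_pow_dvd_mul_choose {p n k r : ℕ} (hp : p.Prime) (hk : 1 ≤ k) (hkn : k ≤ n)
    (hn : n < p ^ r) : ¬ p ^ r ∣ k * n.choose k := by
  have hk0 : k ≠ 0 := by omega
  have hc0 : n.choose k ≠ 0 := (Nat.choose_pos hkn).ne'
  have hv : k.factorization p < r := by
    rw [← Nat.pow_lt_pow_iff_right hp.one_lt]
    exact (Nat.ordProj_le p hk0).trans_lt (hkn.trans_lt hn)
  rw [hp.pow_dvd_iff_le_factorization (mul_ne_zero hk0 hc0), Nat.factorization_mul hk0 hc0,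
    Finsupp.add_apply,
    Nat.factorization_choose hp hkn (Nat.log_lt_of_lt_pow (by omega) hn)]
  have hcarry : {i ∈ Ico 1 r | p ^ i ≤ k % p ^ i + (n - k) % p ^ i} ⊆
      Ico (k.factorization p + 1) r := by
    intro i hi
    simp only [mem_filter, mem_Ico] at hi ⊢
    refine ⟨?_, hi.1.2⟩
    by_contra! h
    have hdvd : p ^ i ∣ k := (hp.pow_dvd_iff_le_factorization hk0).2 (by omega)
    have hlt := Nat.mod_lt (n - k) (pow_pos hp.pos i)
    rw [Nat.mod_eq_zero_of_dvd hdvd] at hi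
    omega
  have hcard := card_le_card hcarry
  rw [Nat.card_Ico] at hcard
  omega

theorem inv_padicNorm_le_of_not_dvd {p s x : ℕ} [Fact p.Prime] (hx : ¬ p ^ (s + 1) ∣ x) :
    (padicNorm p x)⁻¹ ≤ (p : ℚ) ^ s := by
  have hp : p.Prime := Fact.out
  have hx0 : x ≠ 0 := by
    rintro rfl
    exact hx (dvd_zero _)
  rw [padicValNat_dvd_iff_le hx0] at hx
  rw [padicNorm.eq_zpow_of_nonzero (mod_cast hx0), padicValRat.of_nat, zpow_neg, inv_inv,
    zpow_natCast]
  exact pow_le_pow_right₀ (mod_cast hp.one_le) (by omega)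

theorem pcong_zero_of_padicNorm_le {p m : ℕ} [Fact p.Prime] {a : ℚ}
    (ha : padicNorm p a ≤ (p : ℚ) ^ (-m : ℤ)) : pcong p m a 0 := by
  have hp : p.Prime := Fact.out
  rcases eq_or_ne a 0 with h0 | h0
  · exact Or.inl h0
  · right
    rw [padicNorm.eq_zpow_of_nonzero h0, zpow_le_zpow_iff_right₀ (mod_cast hp.one_lt)] at ha
    rw [sub_zero]
    omega

theorem stmt_14 (p : ℕ) (hp : p.Prime) (hodd : Odd p) (r : ℕ) (hr : 2 ≤ r)
    (P : ℚ)
    (hP : P = -(p : ℚ) ^ (3 * r) * (((2 * p ^ r - 1).choose (p ^ r - 1) : ℕ) : ℚ) ^ 2 /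
      ((2 * (p : ℚ) ^ r - 1) * 4 ^ (3 * p ^ r - 3))) :
    pcong p (r + 2)
      (P * ∑ k ∈ Icc 1 ((p ^ r - 1) / 2),
        (-4) ^ k / (((2 * k).choose k : ℕ) : ℚ) *
          (((2 * p ^ r + 2 * k - 2).choose (2 * k - 2) : ℕ) : ℚ) /
          ((k : ℚ) * (2 * k - 1)) * (((2 * p ^ r - 2).choose (p ^ r - k - 1) : ℕ) : ℚ))
      0 := by
  have : Fact p.Prime := ⟨hp⟩
  obtain ⟨s, rfl⟩ : ∃ s, r = s + 1 := ⟨r - 1, by omega⟩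
  have hp0 : (p : ℚ) ≠ 0 := mod_cast hp.ne_zero
  have hPnorm : padicNorm p P ≤ (p : ℚ) ^ (-(3 * (s + 1) : ℕ) : ℤ) := by
    have hnum : padicNorm p ((-(p : ℤ) ^ (3 * (s + 1)) *
        (((2 * p ^ (s + 1) - 1).choose (p ^ (s + 1) - 1) : ℕ) : ℤ) ^ 2 : ℤ) : ℚ) ≤
        (p : ℚ) ^ (-(3 * (s + 1) : ℕ) : ℤ) := by
      rw [← padicNorm.dvd_iff_norm_le]
      push_cast
      exact Dvd.dvd.mul_right ((dvd_neg).2 dvd_rfl) _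
    have hden : padicNorm p (((2 * (p : ℤ) ^ (s + 1) - 1) *
        4 ^ (3 * p ^ (s + 1) - 3) : ℤ) : ℚ) = 1 := by
      rw [padicNorm.int_eq_one_iff]
      have hpp : Prime (p : ℤ) := Nat.prime_iff_prime_int.1 hp
      intro h
      rcases hpp.dvd_or_dvd h with h | h
      · have h1 : (p : ℤ) ∣ 2 * (p : ℤ) ^ (s + 1) :=
          Dvd.dvd.mul_left (dvd_pow_self _ (by omega)) _
        have h2 := dvd_sub h1 h
        rw [sub_sub_cancel] at h2
        exact hpp.not_dvd_one h2
      · have h1 : p ∣ 2 ^ 2 := by exact_mod_cast hpp.dvd_of_dvd_pow h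
        have h2 := (Nat.prime_dvd_prime_iff_eq hp Nat.prime_two).1 (hp.dvd_of_dvd_pow h1)
        rw [h2] at hodd
        exact absurd hodd (by decide)
    push_cast at hnum hden
    rw [hP, padicNorm.div, hden, div_one]
    exact_mod_cast hnum
  have hterm : ∀ k ∈ Icc 1 ((p ^ (s + 1) - 1) / 2),
      padicNorm p ((-4) ^ k / (((2 * k).choose k : ℕ) : ℚ) *
          (((2 * p ^ (s + 1) + 2 * k - 2).choose (2 * k - 2) : ℕ) : ℚ) /
          ((k : ℚ) * (2 * k - 1)) *
          (((2 * p ^ (s + 1) - 2).choose (p ^ (s + 1) - k - 1) : ℕ) : ℚ)) ≤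
        (p : ℚ) ^ s * (p : ℚ) ^ s := by
    intro k hk
    rw [mem_Icc] at hk
    have hchoose := inv_padicNorm_le_of_not_dvd
      (not_prime_pow_dvd_mul_choose hp hk.1 (by omega : k ≤ 2 * k)
        (by omega : 2 * k < p ^ (s + 1)))
    have hlin : (padicNorm p ((2 * k - 1 : ℕ) : ℚ))⁻¹ ≤ (p : ℚ) ^ s :=
      inv_padicNorm_le_of_not_dvd fun h => by
        have := Nat.le_of_dvd (by omega) h
        omega
    have hint := padicNorm.of_int (p := p) ((-4) ^ k *
      (((2 * p ^ (s + 1) + 2 * k - 2).choose (2 * k - 2) : ℕ) : ℤ) *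
      (((2 * p ^ (s + 1) - 2).choose (p ^ (s + 1) - k - 1) : ℕ) : ℤ))
    push_cast at hint hchoose
    rw [Nat.cast_sub (by omega)] at hlin
    push_cast at hlin
    calc _ = padicNorm p ((-4) ^ k *
          (((2 * p ^ (s + 1) + 2 * k - 2).choose (2 * k - 2) : ℕ) : ℚ) *
          (((2 * p ^ (s + 1) - 2).choose (p ^ (s + 1) - k - 1) : ℕ) : ℚ)) *
          ((padicNorm p (k * ((2 * k).choose k : ℕ)))⁻¹ * (padicNorm p (2 * k - 1))⁻¹) := by
          rw [← mul_inv, ← padicNorm.mul, ← div_eq_mul_inv, ← padicNorm.div]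
          congr 1
          simp only [div_eq_mul_inv, mul_inv]
          ring
      _ ≤ 1 * ((p : ℚ) ^ s * (p : ℚ) ^ s) := by
          gcongr
          · exact mul_nonneg (inv_nonneg.2 (padicNorm.nonneg _)) (inv_nonneg.2 (padicNorm.nonneg _))
          · exact inv_nonneg.2 (padicNorm.nonneg _)
      _ = _ := one_mul _
  apply pcong_zero_of_padicNorm_le
  rw [padicNorm.mul]
  calc _ ≤ (p : ℚ) ^ (-(3 * (s + 1) : ℕ) : ℤ) * ((p : ℚ) ^ s * (p : ℚ) ^ s) := by
        gcongr
        · exact padicNorm.nonneg _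
        · exact padicNorm.sum_le' hterm (by positivity)
    _ = _ := by
        rw [← zpow_natCast, ← zpow_add₀ hp0, ← zpow_add₀ hp0]
        congr 1
        push_cast
        ring
end

section
/- Let p be a prime with p > 3 and r an integer with r ≥ 2. Set P = −p^{3r} · C(2p^r−1, p^r−1)² / ((2p^r−1) · 4^{3p^r−3}). Then P · ((−4)^{(p^r+1)/2} / C(p^r+1, (p^r+1)/2)) · (C(3p^r−1, p^r−1) / (((p^r+1)/2) · p^r)) · C(2p^r−2, (p^r−3)/2) ≡ −(−1)^{(p^r−1)/2} · p^r · (1 − 3p·q_p(2)) (mod p^{r+2}). -/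
open Finset

/-- The signed binomial coefficient `(-1)^k * C(N-1, k)`, formally `∏_{1 ≤ i ≤ k} (1 - N / i)`. -/
def signedChoose (N k : ℕ) : ℤ := (-1) ^ k * ((N - 1).choose k : ℤ)

lemma signedChoose_zero (N : ℕ) : signedChoose N 0 = 1 := by simp [signedChoose]

lemma choose_eq_signedChoose (N k : ℕ) :
    ((N - 1).choose k : ℤ) = (-1) ^ k * signedChoose N k := by
  rw [signedChoose, ← mul_assoc, ← mul_pow]
  simp

lemma signedChoose_succ {N : ℕ} (hN : 1 ≤ N) (k : ℕ) :
    ((k : ℤ) + 1) * signedChoose N (k + 1) = ((k : ℤ) + 1 - N) * signedChoose N k := by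
  have h : ((N - 1).choose (k + 1) : ℤ) * (k + 1) = (N - 1).choose k * (N - 1 - k) := by
    rcases le_or_gt k (N - 1) with hk | hk
    · have := Nat.choose_succ_right_eq (N - 1) k
      zify [hk, hN] at this
      exact this
    · rw [Nat.choose_eq_zero_of_lt hk, Nat.choose_eq_zero_of_lt (by omega)]
      simp
  unfold signedChoose
  rw [pow_succ]
  linear_combination (-(-1) ^ k : ℤ) * h

lemma isUnit_natCast_zmod_prime_sq {p k : ℕ} (hp : p.Prime) (hk : ¬ p ∣ k) :
    IsUnit (k : ZMod (p ^ 2)) := by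
  rw [ZMod.isUnit_iff_coprime]
  exact ((hp.coprime_iff_not_dvd.2 hk).symm).pow_right 2

lemma prime_sq_cast_zmod (p : ℕ) : (p : ZMod (p ^ 2)) ^ 2 = 0 := by
  exact_mod_cast ZMod.natCast_self (p ^ 2)

lemma exists_signedChoose_mul_eq {p : ℕ} (hp : p.Prime) {N : ℕ} (hN : 1 ≤ N) (hpN : p ∣ N)
    (K : ℕ) :
    ∃ U V : ℤ, IsUnit (U : ZMod (p ^ 2)) ∧ (U : ZMod (p ^ 2)) = V ∧
      U * signedChoose (p * N) K = V * signedChoose N (K / p) := by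
  have hpN1 : 1 ≤ p * N := Nat.mul_pos hp.pos hN
  induction K with
  | zero => exact ⟨1, 1, by simp, rfl, by simp [signedChoose_zero]⟩
  | succ K ih =>
    obtain ⟨U, V, hU, hUV, h⟩ := ih
    have hrec := signedChoose_succ hpN1 K
    by_cases hK : p ∣ K + 1
    · refine ⟨U, V, hU, hUV, ?_⟩
      have hdiv : (K + 1) / p = K / p + 1 := Nat.succ_div_of_dvd hK
      rw [hdiv]
      obtain ⟨j, hj⟩ := hK
      have hj' : K / p + 1 = j := by
        rw [← hdiv, hj, Nat.mul_div_cancel_left _ hp.pos]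
      have hrec' := signedChoose_succ hN (K / p)
      have hpj : ((K : ℤ) + 1) = p * (((K / p : ℕ) : ℤ) + 1) := by
        rw [← hj'] at hj
        exact_mod_cast hj
      have hne : ((K : ℤ) + 1) ≠ 0 := by positivity
      apply mul_left_cancel₀ hne
      rw [Nat.cast_mul] at hrec
      rw [hpj] at hrec ⊢
      linear_combination U * hrec + (p * (((K / p : ℕ) : ℤ) + 1) - p * N) * h - p * V * hrec'
    · have hdiv : (K + 1) / p = K / p := Nat.succ_div_of_not_dvd hK
      have hu := isUnit_natCast_zmod_prime_sq hp hK
      refine ⟨((K : ℤ) + 1) * U, ((K : ℤ) + 1 - (p * N : ℕ)) * V, ?_, ?_, ?_⟩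
      · push_cast at hu ⊢
        exact hu.mul hU
      · have h0 : ((p * N : ℕ) : ZMod (p ^ 2)) = 0 := by
          rw [ZMod.natCast_eq_zero_iff, sq]
          exact Nat.mul_dvd_mul_left p hpN
        push_cast at h0 ⊢
        rw [h0, hUV]
        ring
      · rw [hdiv]
        linear_combination U * hrec + ((K : ℤ) + 1 - (p * N : ℕ)) * h

lemma signedChoose_prime_mul {p : ℕ} (hp : p.Prime) {N : ℕ} (hN : 1 ≤ N) (hpN : p ∣ N) (K : ℕ) :
    (signedChoose (p * N) K : ZMod (p ^ 2)) = signedChoose N (K / p) := by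
  obtain ⟨U, V, hU, hUV, h⟩ := exists_signedChoose_mul_eq hp hN hpN K
  have h' := congrArg (Int.cast : ℤ → ZMod (p ^ 2)) h
  push_cast at h'
  rw [← hUV] at h'
  exact hU.mul_left_cancel h'

lemma prime_pow_sub_one_div_two_div {p : ℕ} (hp : p.Prime) (hp2 : p ≠ 2) (r : ℕ) :
    (p ^ (r + 1) - 1) / 2 / p = (p ^ r - 1) / 2 := by
  obtain ⟨a, ha⟩ := hp.odd_of_ne_two hp2
  obtain ⟨b, hb⟩ := (hp.odd_of_ne_two hp2).pow (n := r)
  have h : (p ^ (r + 1) - 1) / 2 = p * b + a := by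
    rw [pow_succ, hb]
    have : (2 * b + 1) * p = 2 * (p * b + a) + 1 := by linear_combination ha
    omega
  rw [h, hb, Nat.mul_add_div hp.pos, Nat.div_eq_of_lt (by omega)]
  omega

lemma prime_pow_sub_one_div {p : ℕ} (hp : p.Prime) (r : ℕ) :
    (p ^ (r + 1) - 1) / p = p ^ r - 1 := by
  have h1 := hp.pos
  have h2 : 1 ≤ p ^ r := Nat.pos_of_ne_zero (pow_ne_zero _ hp.ne_zero)
  have h : p ^ (r + 1) - 1 = p * (p ^ r - 1) + (p - 1) := by
    have : 1 ≤ p ^ (r + 1) := Nat.pos_of_ne_zero (pow_ne_zero _ hp.ne_zero)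
    zify [h1, h2, this]
    ring
  rw [h, Nat.mul_add_div hp.pos, Nat.div_eq_of_lt (by omega), add_zero]

lemma signedChoose_half_prime_pow {p : ℕ} (hp : p.Prime) (hp2 : p ≠ 2) {a : ℕ} (ha : 1 ≤ a)
    (r : ℕ) :
    (signedChoose (a * p ^ (r + 1)) ((p ^ (r + 1) - 1) / 2) : ZMod (p ^ 2)) =
      signedChoose (a * p) ((p - 1) / 2) := by
  induction r with
  | zero => simp
  | succ r ih =>
    rw [← ih, ← prime_pow_sub_one_div_two_div hp hp2 (r + 1)]
    have h := signedChoose_prime_mul hp (N := a * p ^ (r + 1))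
      (Nat.mul_pos ha (pow_pos hp.pos _)) (Dvd.intro_left (a * p ^ r) (by ring))
      ((p ^ (r + 1 + 1) - 1) / 2)
    rw [← h]
    congr 2
    ring

lemma signedChoose_prime_pow_sub_one {p : ℕ} (hp : p.Prime) {a : ℕ} (ha : 1 ≤ a) (r : ℕ) :
    (signedChoose (a * p ^ (r + 1)) (p ^ (r + 1) - 1) : ZMod (p ^ 2)) =
      signedChoose (a * p) (p - 1) := by
  induction r with
  | zero => simp
  | succ r ih =>
    rw [← ih, ← prime_pow_sub_one_div hp (r + 1)]
    have h := signedChoose_prime_mul hp (N := a * p ^ (r + 1))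
      (Nat.mul_pos ha (pow_pos hp.pos _)) (Dvd.intro_left (a * p ^ r) (by ring))
      (p ^ (r + 1 + 1) - 1)
    rw [← h]
    congr 2
    ring

lemma signedChoose_succ_zmod {p : ℕ} (hp : p.Prime) {a : ℕ} (ha : 1 ≤ a) (k : ℕ) :
    ((k : ZMod (p ^ 2)) + 1) * signedChoose (a * p) (k + 1) =
      ((k : ZMod (p ^ 2)) + 1 - a * p) * signedChoose (a * p) k := by
  have h := congrArg (Int.cast : ℤ → ZMod (p ^ 2))
    (signedChoose_succ (Nat.mul_pos ha hp.pos) k)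
  push_cast at h
  exact h

lemma isUnit_succ_zmod_prime_sq {p k : ℕ} (hp : p.Prime) (hk : k + 1 < p) :
    IsUnit ((k : ZMod (p ^ 2)) + 1) := by
  exact_mod_cast isUnit_natCast_zmod_prime_sq hp (Nat.not_dvd_of_pos_of_lt k.succ_pos hk)

lemma prime_mul_signedChoose {p : ℕ} (hp : p.Prime) {a : ℕ} (ha : 1 ≤ a) {k : ℕ} (hk : k < p) :
    (p : ZMod (p ^ 2)) * signedChoose (a * p) k = p := by
  induction k with
  | zero => simp [signedChoose_zero]
  | succ k ih =>
    apply (isUnit_succ_zmod_prime_sq hp hk).mul_left_cancel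
    linear_combination (p : ZMod (p ^ 2)) * signedChoose_succ_zmod hp ha k +
      ((k : ZMod (p ^ 2)) + 1) * ih (by omega) -
      a * signedChoose (a * p) k * prime_sq_cast_zmod p

lemma signedChoose_mul_prime {p : ℕ} (hp : p.Prime) {a : ℕ} (ha : 1 ≤ a) {k : ℕ} (hk : k < p) :
    (signedChoose (a * p) k : ZMod (p ^ 2)) = 1 + a * (signedChoose p k - 1) := by
  induction k with
  | zero => simp [signedChoose_zero]
  | succ k ih =>
    have h1 := signedChoose_succ_zmod hp le_rfl k
    have h2 := prime_mul_signedChoose hp le_rfl (k := k) (by omega)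
    rw [one_mul, Nat.cast_one, one_mul] at h1
    rw [one_mul] at h2
    apply (isUnit_succ_zmod_prime_sq hp hk).mul_left_cancel
    linear_combination signedChoose_succ_zmod hp ha k - a * h1 +
      ((k : ZMod (p ^ 2)) + 1) * ih (by omega) -
      a * prime_mul_signedChoose hp ha (k := k) (by omega) + a * h2

lemma signedChoose_mul_prime_sub_one {p : ℕ} (hp : p.Prime) (hp2 : p ≠ 2) {a : ℕ} (ha : 1 ≤ a) :
    (signedChoose (a * p) (p - 1) : ZMod (p ^ 2)) = 1 := by
  rw [signedChoose_mul_prime hp ha (Nat.sub_lt hp.pos one_pos)]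
  have h : signedChoose p (p - 1) = 1 := by
    simp [signedChoose, (hp.even_sub_one hp2).neg_one_pow]
  simp [h]

/-- Partial sums of the row `p - 1` of Pascal's triangle modulo `p ^ 2`. -/
lemma two_mul_sum_choose_prime_sub_one {p : ℕ} (hp : p.Prime) {j : ℕ} (hj : 2 * j < p) :
    2 * ∑ k ∈ range (2 * j + 1), ((p - 1).choose k : ZMod (p ^ 2)) = 1 + signedChoose p j := by
  have hs (k : ℕ) : ((p - 1).choose k : ZMod (p ^ 2)) = (-1) ^ k * signedChoose p k := by
    exact_mod_cast congrArg (Int.cast : ℤ → ZMod (p ^ 2)) (choose_eq_signedChoose p k)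
  induction j with
  | zero => norm_num [signedChoose_zero]
  | succ j ih =>
    have hrec (k : ℕ) := signedChoose_succ_zmod hp le_rfl k
    have hmul {k : ℕ} (hk : k < p) := prime_mul_signedChoose hp le_rfl hk
    simp only [one_mul, Nat.cast_one] at hrec hmul
    have ih := ih (by omega)
    have h1 := hrec j
    have h2 := hrec (2 * j + 1)
    have h3 := hmul (k := j) (by omega)
    have h4 := hmul (k := 2 * j + 1) (by omega)
    rw [show 2 * (j + 1) + 1 = 2 * j + 1 + 1 + 1 by ring, sum_range_succ, sum_range_succ,
      mul_add, mul_add, ih, hs (2 * j + 1), hs (2 * j + 1 + 1),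
      Odd.neg_one_pow ⟨j, rfl⟩, Even.neg_one_pow ⟨j + 1, by ring⟩]
    push_cast at h2
    apply (isUnit_succ_zmod_prime_sq hp (k := j) (by omega)).mul_left_cancel
    linear_combination h2 - h1 - h4 + h3

lemma signedChoose_half_prime {p : ℕ} (hp : p.Prime) (hp2 : p ≠ 2) :
    (signedChoose p ((p - 1) / 2) : ZMod (p ^ 2)) = 1 + 2 * (2 ^ (p - 1) - 1) := by
  obtain ⟨h, hh⟩ := hp.odd_of_ne_two hp2
  have hsum := two_mul_sum_choose_prime_sub_one hp (j := (p - 1) / 2) (by omega)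
  have hrow : ∑ k ∈ range (2 * ((p - 1) / 2) + 1), ((p - 1).choose k : ZMod (p ^ 2)) =
      2 ^ (p - 1) := by
    rw [show 2 * ((p - 1) / 2) + 1 = p - 1 + 1 by omega]
    exact_mod_cast congrArg (Nat.cast : ℕ → ZMod (p ^ 2)) (Nat.sum_range_choose (p - 1))
  rw [hrow] at hsum
  linear_combination -hsum

lemma two_pow_prime_pow_sub_one {p : ℕ} (hp : p.Prime) (hp2 : p ≠ 2) (r : ℕ) :
    (2 : ZMod (p ^ 2)) ^ (p ^ (r + 1) - 1) = 2 ^ (p - 1) := by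
  induction r with
  | zero => simp
  | succ r ih =>
    have hcop : Nat.Coprime 2 (p ^ 2) :=
      ((Nat.coprime_primes Nat.prime_two hp).2 hp2.symm).pow_right 2
    have hpow : (2 : ZMod (p ^ 2)) ^ (p * (p - 1)) = 1 := by
      have h := ZMod.pow_totient (ZMod.unitOfCoprime 2 hcop)
      rw [Nat.totient_prime_pow_succ hp, pow_one] at h
      have h' := congrArg Units.val h
      rwa [Units.val_pow_eq_pow_val, ZMod.coe_unitOfCoprime, Units.val_one, Nat.cast_ofNat] at h'
    have h1 := hp.pos
    have h2 : 1 ≤ p ^ (r + 1) := Nat.pos_of_ne_zero (pow_ne_zero _ hp.ne_zero)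
    have hexp : p ^ (r + 1 + 1) - 1 = p ^ (r + 1) - 1 + p * (p - 1) * p ^ r := by
      have h3 : 1 ≤ p ^ (r + 1 + 1) := Nat.pos_of_ne_zero (pow_ne_zero _ hp.ne_zero)
      zify [h1, h2, h3]
      ring
    rw [hexp, pow_add, pow_mul, hpow, one_pow, mul_one, ih]

lemma two_pow_sub_one_sq_zmod {p : ℕ} (hp : p.Prime) (hp2 : p ≠ 2) :
    ((2 : ZMod (p ^ 2)) ^ (p - 1) - 1) ^ 2 = 0 := by
  have hcop : IsCoprime (2 : ℤ) p := by
    exact_mod_cast (Nat.coprime_primes Nat.prime_two hp).2 hp2.symm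
  obtain ⟨c, hc⟩ := (Int.ModEq.pow_card_sub_one_eq_one hp hcop).symm.dvd
  have hc' := congrArg (Int.cast : ℤ → ZMod (p ^ 2)) hc
  push_cast at hc'
  rw [hc', mul_pow, prime_sq_cast_zmod, zero_mul]

lemma product_closed_form {l n : ℕ} (hn : n = 2 * l + 3) :
    -(n : ℚ) ^ 3 * (((2 * n - 1).choose (n - 1) : ℕ) : ℚ) ^ 2 / ((2 * (n : ℚ) - 1) * 4 ^ (3 * n - 3))
      * ((-4) ^ ((n + 1) / 2) / (((n + 1).choose ((n + 1) / 2) : ℕ) : ℚ)) *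
        ((((3 * n - 1).choose (n - 1) : ℕ) : ℚ) / (((((n + 1) / 2 : ℕ)) : ℚ) * (n : ℚ))) *
        (((2 * n - 2).choose ((n - 3) / 2) : ℕ) : ℚ) =
      (-1) ^ ((n - 1) / 2) * n *
        ((((2 * n - 1).choose (n - 1) : ℕ) : ℚ) ^ 2 * (((3 * n - 1).choose (n - 1) : ℕ) : ℚ) *
          (((2 * n - 1).choose ((n - 1) / 2) : ℕ) : ℚ) * (n - 1)) /
        ((2 * n - 1) ^ 2 * (2 ^ (n - 1)) ^ 5 * (((n - 1).choose ((n - 1) / 2) : ℕ) : ℚ)) := by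
  have e1 : (n + 1) / 2 = l + 2 := by omega
  have e2 : (n - 1) / 2 = l + 1 := by omega
  have e3 : (n - 3) / 2 = l := by omega
  have hcentral : (((n + 1).choose (l + 2) : ℕ) : ℚ) * (n + 1) =
      4 * n * (((n - 1).choose (l + 1) : ℕ) : ℚ) := by
    have h := Nat.succ_mul_centralBinom_succ (l + 1)
    rw [Nat.centralBinom_eq_two_mul_choose, Nat.centralBinom_eq_two_mul_choose,
      show 2 * (l + 1 + 1) = n + 1 by omega, show 2 * (l + 1) = n - 1 by omega,
      show n - 1 + 1 = n by omega] at h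
    have h' := congrArg (Nat.cast : ℕ → ℚ) h
    have hn' : (n : ℚ) = 2 * l + 3 := by exact_mod_cast hn
    push_cast at h'
    linear_combination 2 * h' + (((n + 1).choose (l + 2) : ℕ) : ℚ) * hn'
  have hshift : (((2 * n - 2).choose l : ℕ) : ℚ) * (2 * n - 1) =
      (((2 * n - 1).choose (l + 1) : ℕ) : ℚ) * ((n - 1) / 2) := by
    have h := Nat.add_one_mul_choose_eq (2 * n - 2) l
    rw [show 2 * n - 2 + 1 = 2 * n - 1 by omega] at h
    have h' := congrArg (Nat.cast : ℕ → ℚ) h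
    have hn' : (n : ℚ) = 2 * l + 3 := by exact_mod_cast hn
    push_cast [show 1 ≤ 2 * n by omega] at h'
    rw [mul_comm, h', hn']
    ring
  have hn0 : (n : ℚ) ≠ 0 := by
    rw [hn]
    positivity
  have hn1 : (n : ℚ) + 1 ≠ 0 := by positivity
  have hn2 : 2 * (n : ℚ) - 1 ≠ 0 := by
    rw [hn]
    push_cast
    ring_nf
    positivity
  have hB : (((n - 1).choose (l + 1) : ℕ) : ℚ) ≠ 0 := by
    exact_mod_cast (Nat.choose_pos (by omega)).ne'
  have ht : (2 : ℚ) ^ (n - 1) ≠ 0 := by positivity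
  have hhalf : (((l + 2 : ℕ)) : ℚ) = (n + 1) / 2 := by
    rw [hn]
    push_cast
    ring
  have h4 : (4 : ℚ) ^ (3 * n - 3) = (2 ^ (n - 1)) ^ 6 := by
    rw [show (4 : ℚ) = 2 ^ 2 by norm_num, ← pow_mul, ← pow_mul]
    congr 1
    omega
  have h5 : (-4 : ℚ) ^ (l + 2) = -((-1) ^ (l + 1)) * (4 * 2 ^ (n - 1)) := by
    rw [show n - 1 = 2 * (l + 1) by omega, pow_mul, show (-4 : ℚ) = (-1) * 4 by norm_num, mul_pow]
    ring
  rw [e1, e2, e3, eq_div_of_mul_eq hn1 hcentral, eq_div_of_mul_eq hn2 hshift, hhalf, h4, h5]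
  generalize (2 : ℚ) ^ (n - 1) = t at *
  generalize (-1 : ℚ) ^ (l + 1) = s at *
  generalize (((n - 1).choose (l + 1) : ℕ) : ℚ) = B at *
  field_simp

lemma pcong_of_sub_eq {p m : ℕ} (hp : p.Prime) {a b : ℚ} {y M : ℤ} (hM : ¬ (p : ℤ) ∣ M)
    (h : a - b = p ^ m * y / M) : pcong p m a b := by
  have : Fact p.Prime := ⟨hp⟩
  by_cases hab : a = b
  · exact Or.inl hab
  right
  have hne : a - b ≠ 0 := sub_ne_zero.2 hab
  have hM0 : (M : ℚ) ≠ 0 := by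
    rintro h0
    exact hM (by simp [Int.cast_eq_zero.1 h0])
  have hp0 : (p : ℚ) ≠ 0 := by exact_mod_cast hp.ne_zero
  have hy0 : (y : ℚ) ≠ 0 := by
    rintro h0
    simp [h, h0] at hne
  rw [h, padicValRat.div (mul_ne_zero (pow_ne_zero _ hp0) hy0) hM0,
    padicValRat.mul (pow_ne_zero _ hp0) hy0, padicValRat.pow,
    padicValRat.self hp.one_lt, padicValRat.of_int, padicValRat.of_int,
    padicValInt.eq_zero_of_not_dvd hM]
  simp

theorem stmt_15 (p : ℕ) (hp : p.Prime) (hp3 : 3 < p) (r : ℕ) (hr : 2 ≤ r)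
    (P : ℚ)
    (hP : P = -(p : ℚ) ^ (3 * r) * (((2 * p ^ r - 1).choose (p ^ r - 1) : ℕ) : ℚ) ^ 2 /
      ((2 * (p : ℚ) ^ r - 1) * 4 ^ (3 * p ^ r - 3))) :
    pcong p (r + 2)
      (P * ((-4) ^ ((p ^ r + 1) / 2) / (((p ^ r + 1).choose ((p ^ r + 1) / 2) : ℕ) : ℚ)) *
        ((((3 * p ^ r - 1).choose (p ^ r - 1) : ℕ) : ℚ) /
          (((((p ^ r + 1) / 2 : ℕ)) : ℚ) * (p : ℚ) ^ r)) *
        (((2 * p ^ r - 2).choose ((p ^ r - 3) / 2) : ℕ) : ℚ))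
      (-((-1) ^ ((p ^ r - 1) / 2) * (p : ℚ) ^ r *
        (1 - 3 * p * (((2 : ℚ) ^ (p - 1) - 1) / (p : ℚ))))) := by
  have hp2 : p ≠ 2 := by omega
  obtain ⟨s, rfl⟩ : ∃ s, r = s + 1 := ⟨r - 1, by omega⟩
  have hA := signedChoose_prime_pow_sub_one hp (a := 2) (by norm_num) s
  have hD := signedChoose_prime_pow_sub_one hp (a := 3) (by norm_num) s
  have hF := signedChoose_half_prime_pow hp hp2 (a := 2) (by norm_num) s
  have hB := signedChoose_half_prime_pow hp hp2 (a := 1) le_rfl s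
  have ht := two_pow_prime_pow_sub_one hp hp2 s
  have hu := two_pow_sub_one_sq_zmod hp hp2
  rw [signedChoose_mul_prime_sub_one hp hp2 (by norm_num)] at hA hD
  rw [signedChoose_mul_prime hp (by norm_num) (by omega), signedChoose_half_prime hp hp2] at hF
  rw [one_mul, one_mul, signedChoose_half_prime hp hp2] at hB
  have hn0 : ((p ^ (s + 1) : ℕ) : ZMod (p ^ 2)) = 0 := by
    rw [ZMod.natCast_eq_zero_iff]
    exact pow_dvd_pow p hr
  have hodd : Odd (p ^ (s + 1)) := (hp.odd_of_ne_two hp2).pow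
  have hn3 : 3 < p ^ (s + 1) := hp3.trans_le (Nat.le_self_pow (by omega) p)
  have hP' : P = -((p ^ (s + 1) : ℕ) : ℚ) ^ 3 *
      (((2 * p ^ (s + 1) - 1).choose (p ^ (s + 1) - 1) : ℕ) : ℚ) ^ 2 /
      ((2 * ((p ^ (s + 1) : ℕ) : ℚ) - 1) * 4 ^ (3 * p ^ (s + 1) - 3)) := by
    rw [hP]
    push_cast
    ring
  have hq : 3 * (p : ℚ) * ((2 ^ (p - 1) - 1) / p) = 3 * (2 ^ (p - 1) - 1) := by
    have : (p : ℚ) ≠ 0 := by exact_mod_cast hp.ne_zero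
    field_simp
  obtain ⟨l, hl⟩ : ∃ l, p ^ (s + 1) = 2 * l + 3 := by
    obtain ⟨k, hk⟩ := hodd
    exact ⟨k - 1, by omega⟩
  have hform := product_closed_form hl
  rw [← hP'] at hform
  have hsign (N k : ℕ) : ((N - 1).choose k : ZMod (p ^ 2)) = (-1) ^ k * signedChoose N k := by
    exact_mod_cast congrArg (Int.cast : ℤ → ZMod (p ^ 2)) (choose_eq_signedChoose N k)
  have heven : ((-1 : ZMod (p ^ 2))) ^ (p ^ (s + 1) - 1) = 1 :=
    (Nat.Odd.sub_odd hodd odd_one).neg_one_pow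
  have hA' := hsign (2 * p ^ (s + 1)) (p ^ (s + 1) - 1)
  have hD' := hsign (3 * p ^ (s + 1)) (p ^ (s + 1) - 1)
  have hF' := hsign (2 * p ^ (s + 1)) ((p ^ (s + 1) - 1) / 2)
  have hB' := hsign (p ^ (s + 1)) ((p ^ (s + 1) - 1) / 2)
  rw [hA, heven, mul_one] at hA'
  rw [hD, heven, mul_one] at hD'
  rw [hF] at hF'
  rw [hB] at hB'
  rw [← Nat.cast_pow, hform, hq]
  clear hform hq hP hP' hA hD hF hB hsign heven hl
  generalize (2 * p ^ (s + 1) - 1).choose (p ^ (s + 1) - 1) = A at *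
  generalize (3 * p ^ (s + 1) - 1).choose (p ^ (s + 1) - 1) = D at *
  generalize (2 * p ^ (s + 1) - 1).choose ((p ^ (s + 1) - 1) / 2) = F at *
  generalize (p ^ (s + 1) - 1).choose ((p ^ (s + 1) - 1) / 2) = B at *
  generalize (p ^ (s + 1) - 1) / 2 = m at *
  obtain ⟨M, hM⟩ : ∃ M : ℤ, M = (2 * (p ^ (s + 1) : ℕ) - 1) ^ 2 * (2 ^ (p ^ (s + 1) - 1)) ^ 5 * B :=
    ⟨_, rfl⟩
  have hMz : (M : ZMod (p ^ 2)) = (-1) ^ m * (1 + 7 * (2 ^ (p - 1) - 1)) := by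
    rw [hM]
    push_cast at hn0 ⊢
    rw [ht, hB', hn0]
    generalize (2 : ZMod (p ^ 2)) ^ (p - 1) = t at *
    obtain ⟨u, rfl⟩ : ∃ u, t = 1 + u := ⟨t - 1, by ring⟩
    rw [add_sub_cancel_left] at hu ⊢
    linear_combination (-1) ^ m * (2 * u ^ 4 + 11 * u ^ 3 + 25 * u ^ 2 + 30 * u + 20) * hu
  have hm : ((-1 : ZMod (p ^ 2)) ^ m) ^ 2 = 1 := by
    rw [← pow_mul, mul_comm, pow_mul]
    simp
  have hMu : ¬ (p : ℤ) ∣ M := by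
    rintro ⟨c, rfl⟩
    push_cast at hMz
    have hp1 : (p : ZMod (p ^ 2)) * (p * c) = 0 := by
      linear_combination (c : ZMod (p ^ 2)) * prime_sq_cast_zmod p
    have hunit : IsUnit ((p : ZMod (p ^ 2)) * c) := by
      rw [hMz]
      refine IsUnit.of_mul_eq_one ((-1) ^ m * (1 - 7 * (2 ^ (p - 1) - 1))) ?_
      linear_combination (1 - 49 * ((2 : ZMod (p ^ 2)) ^ (p - 1) - 1) ^ 2) * hm - 49 * hu
    have hpz : (p : ZMod (p ^ 2)) = 0 := hunit.mul_left_eq_zero.1 hp1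
    rw [ZMod.natCast_eq_zero_iff] at hpz
    have := Nat.le_of_dvd hp.pos hpz
    nlinarith
  have hdvd : (p : ℤ) ^ 2 ∣ (A : ℤ) ^ 2 * D * F * ((p ^ (s + 1) : ℕ) - 1) +
      (1 - 3 * (2 ^ (p - 1) - 1)) * M := by
    have h : ((p ^ 2 : ℕ) : ℤ) ∣ (A : ℤ) ^ 2 * D * F * ((p ^ (s + 1) : ℕ) - 1) +
        (1 - 3 * (2 ^ (p - 1) - 1)) * M := by
      rw [← ZMod.intCast_zmod_eq_zero_iff_dvd]
      push_cast at hn0 ⊢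
      rw [hMz, hA', hD', hF', hn0]
      push_cast
      linear_combination -21 * (-1) ^ m * hu
    exact_mod_cast h
  obtain ⟨y, hy⟩ := hdvd
  apply pcong_of_sub_eq hp (y := (-1) ^ m * y) hMu
  have hM0 : (M : ℚ) ≠ 0 := by
    rintro h0
    exact hMu (by simp [Int.cast_eq_zero.1 h0])
  have hMq := congrArg (Int.cast : ℤ → ℚ) hM
  have hyq := congrArg (Int.cast : ℤ → ℚ) hy
  push_cast at hMq hyq ⊢
  rw [← hMq, eq_div_iff hM0, sub_mul, div_mul_cancel₀ _ hM0]
  linear_combination (-1) ^ m * (p : ℚ) ^ (s + 1) * hyq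
end
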